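/- arXiv:2306.10838 — 9 statements merged into one kernel-verified Lean document; each statement's English description precedes it below -/
import Mathlib

section
/- Let m ≥ 1 and let S : (ℤ →₀ ZMod m) → (ℤ →₀ ZMod m) be an additive group endomorphism. Then there exists a finitely supported λ : ℤ →₀ ZMod m with S = S_λ if and only if S is continuous with respect to the topology on ℤ →₀ ZMod m induced by the inclusion into the product space ℤ → ZMod m (where ZMod m is discrete and the product carries the product topology) and S ∘ σ = σ ∘ S. -/
open scoped Topology

/-- The one-dimensional finitary linear cellular automaton `S_lam` on `ZZ ->0 ZMod m`:
`(S_lam a) n = sum_i lam i * a (n + i)`. -/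
noncomputable def SCA (m : ℕ) (lam : ℤ →₀ ZMod m) (a : ℤ →₀ ZMod m) : ℤ →₀ ZMod m :=
  lam.sum fun i c => c • Finsupp.equivMapDomain (Equiv.subRight i) a

/-- The `t`-th power of the right shift: `(sigma^t a) n = a (n - t)`. -/
def shiftT (m : ℕ) (t : ℤ) (a : ℤ →₀ ZMod m) : ℤ →₀ ZMod m :=
  Finsupp.equivMapDomain (Equiv.addRight t) a

/-- Product topology on `ZZ -> ZMod m` with `ZMod m` discrete. -/
def tK (m : ℕ) : TopologicalSpace (ℤ → ZMod m) :=
  @Pi.topologicalSpace ℤ (fun _ => ZMod m) (fun _ => ⊥)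

/-- The topology on `ZZ ->0 ZMod m` induced by the inclusion into `ZZ -> ZMod m`. -/
def tL (m : ℕ) : TopologicalSpace (ℤ →₀ ZMod m) :=
  TopologicalSpace.induced (fun a : ℤ →₀ ZMod m => (a : ℤ → ZMod m)) (tK m)

theorem SCA_apply (m : ℕ) (lam a : ℤ →₀ ZMod m) (n : ℤ) :
    SCA m lam a n = ∑ i ∈ lam.support, lam i * a (n + i) := by
  simp [SCA, Finsupp.sum, Finsupp.finset_sum_apply, Finsupp.equivMapDomain_apply]

theorem shiftT_apply (m : ℕ) (t : ℤ) (a : ℤ →₀ ZMod m) (n : ℤ) :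
    shiftT m t a n = a (n - t) := by
  simp [shiftT, Finsupp.equivMapDomain_apply, sub_eq_add_neg]

theorem SCA_continuous (m : ℕ) (lam : ℤ →₀ ZMod m) :
    Continuous[tL m, tL m] (SCA m lam) := by
  letI : TopologicalSpace (ZMod m) := ⊥
  haveI : DiscreteTopology (ZMod m) := ⟨rfl⟩
  letI : TopologicalSpace (ℤ →₀ ZMod m) := tL m
  have hc : Continuous (fun a : ℤ →₀ ZMod m => (a : ℤ → ZMod m)) := continuous_induced_dom
  refine continuous_induced_rng.2 ?_
  refine continuous_pi fun n => ?_
  have : (fun a => SCA m lam a n) = fun a => ∑ i ∈ lam.support, lam i * a (n + i) := by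
    funext a; exact SCA_apply m lam a n
  change Continuous (fun a => SCA m lam a n)
  rw [this]
  refine continuous_finset_sum _ fun i _ => ?_
  exact continuous_const.mul ((continuous_apply (n + i)).comp hc)

theorem S_single (m : ℕ) (S : (ℤ →₀ ZMod m) →+ (ℤ →₀ ZMod m))
    (h : ∀ a, S (shiftT m 1 a) = shiftT m 1 (S a)) (k : ℤ) (n : ℤ) :
    S (Finsupp.single k 1) n = S (Finsupp.single 0 1) (n - k) := by
  have h1 : ∀ j : ℤ, shiftT m 1 (Finsupp.single j 1) = Finsupp.single (j + 1) 1 := by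
    intro j
    simp [shiftT, Finsupp.equivMapDomain_single]
  have h2 : ∀ j n : ℤ, S (Finsupp.single (j + 1) 1) n = S (Finsupp.single j 1) (n - 1) := by
    intro j n
    rw [← h1, h, shiftT_apply]
  induction k using Int.induction_on generalizing n with
  | zero => simp
  | succ i ih => rw [h2, ih]; congr 1; ring
  | pred i ih =>
    have := h2 (-(i : ℤ) - 1) (n + 1)
    rw [sub_add_cancel, add_sub_cancel_right] at this
    rw [← this, ih]; congr 1; ring

theorem stmt0 (m : ℕ) (hm : 1 ≤ m) (S : (ℤ →₀ ZMod m) →+ (ℤ →₀ ZMod m)) :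
    (∃ lam : ℤ →₀ ZMod m, ∀ a, S a = SCA m lam a) ↔
      (Continuous[tL m, tL m] ⇑S ∧ ∀ a, S (shiftT m 1 a) = shiftT m 1 (S a)) := by
  constructor
  · rintro ⟨lam, hl⟩
    have hS : ⇑S = SCA m lam := funext hl
    refine ⟨hS ▸ SCA_continuous m lam, fun a => ?_⟩
    ext n
    rw [shiftT_apply, hl, hl, SCA_apply, SCA_apply]
    refine Finset.sum_congr rfl fun i _ => ?_
    rw [shiftT_apply]
    congr 2; ring
  · rintro ⟨-, h⟩
    refine ⟨Finsupp.equivMapDomain (Equiv.neg ℤ) (S (Finsupp.single 0 1)), fun a => ?_⟩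
    set lam := Finsupp.equivMapDomain (Equiv.neg ℤ) (S (Finsupp.single 0 1)) with hlam
    have hl : ∀ i, lam i = S (Finsupp.single 0 1) (-i) := by
      intro i; simp [hlam, Finsupp.equivMapDomain_apply]
    induction a using Finsupp.induction_linear with
    | zero => ext n; simp [SCA_apply]
    | add f g hf hg =>
      rw [map_add, hf, hg]
      ext n
      simp [SCA_apply, mul_add, Finset.sum_add_distrib]
    | single k c =>
      have e : Finsupp.single k c = c • (Finsupp.single k 1 : ℤ →₀ ZMod m) := by simp
      rw [e, ZMod.map_smul]
      ext n
      rw [Finsupp.smul_apply, S_single m S h, SCA_apply, Finset.sum_eq_single (k - n)]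
      · rw [hl]; simp [mul_comm]
      · intro b _ hb
        have : k ≠ n + b := by intro h; apply hb; omega
        simp [Finsupp.single_apply, this]
      · intro hb
        rw [Finsupp.notMem_support_iff.1 hb, zero_mul]
end

section
/- Let m ≥ 1. For every λ : ℤ →₀ ZMod m, every a : ℤ →₀ ZMod m and every x : ℤ → ZMod m, one has ∑_{n∈ℤ} a(n)·(T_λ x)(n) = ∑_{n∈ℤ} (S_{λ^∧} a)(n)·x(n), where both sums are finite because a and S_{λ^∧}(a) are finitely supported. (This expresses that the Pontryagin dual of the linear cellular automaton T_λ is the finitary linear cellular automaton S_{λ^∧}.) -/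
/-- The one-dimensional linear cellular automaton `T_lam` on `ZZ -> ZMod m`:
`(T_lam x) n = sum_i lam i * x (n + i)`. -/
noncomputable def TCA (m : ℕ) (lam : ℤ →₀ ZMod m) (x : ℤ → ZMod m) : ℤ → ZMod m :=
  fun n => lam.sum fun i c => c * x (n + i)

/-- Reflection: `(a^) n = a (-n)`. -/
def reflectF (m : ℕ) (a : ℤ →₀ ZMod m) : ℤ →₀ ZMod m :=
  Finsupp.equivMapDomain (Equiv.neg ℤ) a

theorem stmt4 (m : ℕ) (hm : 1 ≤ m) (lam a : ℤ →₀ ZMod m) (x : ℤ → ZMod m) :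
    a.sum (fun n c => c * TCA m lam x n)
      = (SCA m (reflectF m lam) a).sum (fun n c => c * x n) := by
  have key : ∀ b : ℤ →₀ ZMod m, b.sum (fun n c => c * x n)
      = Finsupp.linearCombination (ZMod m) x b := fun b => rfl
  rw [key, SCA, map_finsuppSum, reflectF, Finsupp.equivMapDomain_eq_mapDomain,
    Finsupp.sum_mapDomain_index_inj (Equiv.neg ℤ).injective]
  simp only [map_smul, Finsupp.equivMapDomain_eq_mapDomain,
    Finsupp.linearCombination_mapDomain]
  simp only [Finsupp.linearCombination_apply, TCA,
    Finsupp.sum, Finset.mul_sum, smul_eq_mul]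
  rw [Finset.sum_comm]
  refine Finset.sum_congr rfl fun i _ => Finset.sum_congr rfl fun n _ => ?_
  simp only [Function.comp_apply, Equiv.subRight_apply, Equiv.neg_apply, sub_neg_eq_add]
  ring
end

section
/- Let m ≥ 1 and λ : ℤ →₀ ZMod m. Then the linear cellular automaton T_λ : (ℤ → ZMod m) → (ℤ → ZMod m) is injective if and only if the finitary linear cellular automaton S_λ : (ℤ →₀ ZMod m) → (ℤ →₀ ZMod m) is surjective, and T_λ is surjective if and only if S_λ is injective. -/
lemma exists_iota (m : ℕ) (hm : 1 ≤ m) : ∃ f : ZMod m →+ AddCircle (1 : ℚ),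
    Function.Injective f ∧ ∀ u : AddCircle (1 : ℚ), m • u = 0 → ∃ c, f c = u := by
  have hm0 : (m : ℚ) ≠ 0 := by positivity
  let g : ℤ →+ AddCircle (1 : ℚ) :=
    (zmultiplesHom (AddCircle (1 : ℚ))) (((1 / m : ℚ)) : AddCircle (1 : ℚ))
  have hg : ∀ k : ℤ, g k = (((k / m : ℚ)) : AddCircle (1 : ℚ)) := by
    intro k
    simp only [g, zmultiplesHom_apply]
    rw [← AddCircle.coe_zsmul]
    congr 1
    rw [zsmul_eq_mul]; ring
  have hgm : g (m : ℤ) = 0 := by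
    rw [hg, AddCircle.coe_eq_zero_iff]
    exact ⟨1, by push_cast; rw [div_self hm0]; simp⟩
  refine ⟨ZMod.lift m ⟨g, hgm⟩, ?_, ?_⟩
  · rw [ZMod.lift_injective]
    intro k hk
    change g k = 0 at hk
    rw [hg, AddCircle.coe_eq_zero_iff] at hk
    obtain ⟨n, hn⟩ := hk
    rw [zsmul_eq_mul, mul_one, eq_div_iff hm0] at hn
    rw [ZMod.intCast_zmod_eq_zero_iff_dvd]
    exact ⟨n, by rw [mul_comm]; exact_mod_cast hn.symm⟩
  · intro u hu
    haveI : Fact ((0 : ℚ) < 1) := ⟨one_pos⟩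
    obtain ⟨k, -, hk⟩ := (AddCircle.nsmul_eq_zero_iff (by omega)).1 hu
    refine ⟨((k : ℤ) : ZMod m), ?_⟩
    rw [ZMod.lift_coe]
    change g k = u
    rw [hg, ← hk]; simp

/-- `SCA` as an additive hom. -/
noncomputable def SHom (m : ℕ) (lam : ℤ →₀ ZMod m) : (ℤ →₀ ZMod m) →+ (ℤ →₀ ZMod m) where
  toFun := SCA m lam
  map_zero' := by
    ext n
    simp [SCA, Finsupp.sum, Finsupp.finset_sum_apply, Finsupp.equivMapDomain_apply]
  map_add' a b := by
    ext n
    simp [SCA, Finsupp.sum, Finsupp.finset_sum_apply, Finsupp.equivMapDomain_apply,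
      mul_add, Finset.sum_add_distrib]

/-- The pairing. -/
noncomputable def PhiCA (m : ℕ) (f : ZMod m →+ AddCircle (1 : ℚ)) (x : ℤ → ZMod m) :
    CharacterModule (ℤ →₀ ZMod m) :=
  f.comp (Finsupp.liftAddHom fun n => AddMonoidHom.mulRight (x (-n)))

lemma PhiCA_single (m : ℕ) (f : ZMod m →+ AddCircle (1 : ℚ)) (x : ℤ → ZMod m) (n : ℤ)
    (c : ZMod m) : PhiCA m f x (Finsupp.single n c) = f (c * x (-n)) := by
  change f (Finsupp.liftAddHom (fun n => AddMonoidHom.mulRight (x (-n))) (Finsupp.single n c)) = _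
  simp

lemma PhiCA_T (m : ℕ) (f : ZMod m →+ AddCircle (1 : ℚ)) (lam : ℤ →₀ ZMod m) (x : ℤ → ZMod m) :
    PhiCA m f (TCA m lam x) = CharacterModule.dual (SHom m lam).toIntLinearMap (PhiCA m f x) := by
  apply Finsupp.addHom_ext
  intro n c
  refine (PhiCA_single m f _ n c).trans ?_
  change _ = PhiCA m f x (SCA m lam (Finsupp.single n c))
  have h : SCA m lam (Finsupp.single n c) =
      ∑ i ∈ lam.support, Finsupp.single (n - i) (lam i * c) := by
    simp [SCA, Finsupp.sum, Finsupp.equivMapDomain_single]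
  rw [h, map_sum]
  simp only [PhiCA_single]
  rw [← map_sum]
  congr 1
  simp only [TCA, Finsupp.sum, Finset.mul_sum]
  refine Finset.sum_congr rfl fun i _ => ?_
  rw [show -(n - i) = -n + i by ring]; ring

lemma PhiCA_bij (m : ℕ) (f : ZMod m →+ AddCircle (1 : ℚ)) (hf : Function.Injective f)
    (hs : ∀ u : AddCircle (1 : ℚ), m • u = 0 → ∃ c, f c = u) :
    Function.Bijective (PhiCA m f) := by
  constructor
  · intro x y h
    ext n
    have := congrArg (fun c : CharacterModule (ℤ →₀ ZMod m) => c (Finsupp.single (-n) 1)) h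
    simp only [PhiCA_single, one_mul, neg_neg] at this
    exact hf this
  · intro χ
    have h : ∀ n : ℤ, ∃ c, f c = χ (Finsupp.single (-n) 1) := by
      intro n
      apply hs
      rw [← map_nsmul, Finsupp.smul_single]
      simp
    choose x hx using h
    refine ⟨x, ?_⟩
    apply Finsupp.addHom_ext
    intro n c
    refine (PhiCA_single m f _ n c).trans ?_
    obtain ⟨k, rfl⟩ := ZMod.intCast_surjective c
    rw [← zsmul_eq_mul, map_zsmul, hx, neg_neg, ← map_zsmul, Finsupp.smul_single]
    simp
    rfl

theorem stmt6 (m : ℕ) (hm : 1 ≤ m) (lam : ℤ →₀ ZMod m) :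
    (Function.Injective (TCA m lam) ↔ Function.Surjective (SCA m lam)) ∧
    (Function.Surjective (TCA m lam) ↔ Function.Injective (SCA m lam)) := by
  obtain ⟨f, hf, hs⟩ := exists_iota m hm
  have hb := PhiCA_bij m f hf hs
  have hc : PhiCA m f ∘ TCA m lam =
      CharacterModule.dual (SHom m lam).toIntLinearMap ∘ PhiCA m f :=
    funext fun x => PhiCA_T m f lam x
  constructor
  · rw [← hb.injective.of_comp_iff, hc, Function.Injective.of_comp_iff' _ hb]
    exact CharacterModule.dual_injective_iff_surjective
  · rw [← Function.Surjective.of_comp_iff' hb, hc, hb.surjective.of_comp_iff]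
    exact CharacterModule.dual_surjective_iff_injective
end

section
/- Let p be a prime, k ≥ 1, m = p^k, and λ : ℤ →₀ ZMod m. Then the following are equivalent: (1) S_λ is surjective; (2) S_λ is bijective; (3) the reduced support supp*(λ) has exactly one element. -/
/-- The reduced support `supp*(lam) = {i : lam i is a unit of ZMod m}`. -/
noncomputable def redSupp (m : ℕ) (lam : ℤ →₀ ZMod m) : Finset ℤ :=
  letI := Classical.decPred fun i : ℤ => IsUnit (lam i)
  lam.support.filter fun i => IsUnit (lam i)


noncomputable def Fpoly {m : ℕ} (lam : ℤ →₀ ZMod m) : AddMonoidAlgebra (ZMod m) ℤ :=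
  ∑ i ∈ lam.support, AddMonoidAlgebra.single (-i) (lam i)

theorem Fpoly_coeff {m : ℕ} (lam : ℤ →₀ ZMod m) (n : ℤ) : (Fpoly lam).coeff n = lam (-n) := by
  classical
  have h : ∀ i : ℤ, (-i = n) ↔ (i = -n) := fun i => by omega
  simp only [Fpoly, AddMonoidAlgebra.coeff_sum, Finsupp.finsetSum_apply,
    AddMonoidAlgebra.coeff_single, Finsupp.single_apply, h]
  rw [Finset.sum_ite_eq']
  split_ifs with h1
  · rfl
  · exact (Finsupp.notMem_support_iff.mp h1).symm

theorem SCA_eq {m : ℕ} (lam a : ℤ →₀ ZMod m) :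
    SCA m lam a = (Fpoly lam * AddMonoidAlgebra.ofCoeff a).coeff := by
  ext n
  simp only [SCA, Fpoly, Finsupp.sum, Finset.sum_mul, AddMonoidAlgebra.coeff_sum,
    Finsupp.finsetSum_apply]
  refine Finset.sum_congr rfl fun i _ => ?_
  rw [AddMonoidAlgebra.coeff_single_mul_apply]
  simp [Finsupp.equivMapDomain_apply, add_comm]

theorem isUnit_zmod (p k : ℕ) (hp : p.Prime) (hk : 1 ≤ k) (a : ZMod (p ^ k)) :
    (IsUnit a ↔ ZMod.castHom (dvd_pow_self p (by omega : k ≠ 0)) (ZMod p) a ≠ 0) ∧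
    (¬ IsUnit a → IsNilpotent a) := by
  haveI : NeZero (p ^ k) := ⟨pow_ne_zero _ hp.ne_zero⟩
  obtain ⟨n, rfl⟩ : ∃ n : ℕ, (n : ZMod (p ^ k)) = a := ⟨a.val, by simp⟩
  have h1 : IsUnit (n : ZMod (p ^ k)) ↔ ¬ p ∣ n := by
    rw [ZMod.isUnit_iff_coprime, Nat.coprime_pow_right_iff (by omega), Nat.coprime_comm,
      hp.coprime_iff_not_dvd]
  refine ⟨?_, ?_⟩
  · rw [h1, map_natCast, Ne, ZMod.natCast_eq_zero_iff]
  · rw [h1, not_not]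
    rintro ⟨c, rfl⟩
    refine ⟨k, ?_⟩
    rw [← Nat.cast_pow, ZMod.natCast_eq_zero_iff, mul_pow]
    exact dvd_mul_right _ _

theorem card_of_mul_one {R : Type*} [CommRing R] [IsDomain R] (f g : AddMonoidAlgebra R ℤ)
    (h : f * g = 1) : f.coeff.support.card = 1 := by
  have hf : f ≠ 0 := by rintro rfl; simp at h
  have hg : g ≠ 0 := by rintro rfl; simp at h
  have hf' : 0 < f.coeff.support.card := by
    rw [Finset.card_pos, Finsupp.support_nonempty_iff]
    simpa using hf
  have hg' : 0 < g.coeff.support.card := by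
    rw [Finset.card_pos, Finsupp.support_nonempty_iff]
    simpa using hg
  by_contra hne
  obtain ⟨p1, h1, p2, h2, h12, u1, u2⟩ :=
    TwoUniqueSums.uniqueAdd_of_one_lt_card (A := f.coeff.support) (B := g.coeff.support)
      (by nlinarith [show 2 ≤ f.coeff.support.card by omega])
  have key : ∀ q ∈ f.coeff.support ×ˢ g.coeff.support,
      UniqueAdd f.coeff.support g.coeff.support q.1 q.2 → q.1 + q.2 = 0 := by
    intro q hq u
    have := AddMonoidAlgebra.coeff_mul_add_of_uniqueAdd u
    rw [Finset.mem_product, Finsupp.mem_support_iff, Finsupp.mem_support_iff] at hq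
    by_contra hz
    rw [h, AddMonoidAlgebra.one_def, AddMonoidAlgebra.coeff_single,
      Finsupp.single_eq_of_ne (by assumption)] at this
    exact mul_ne_zero hq.1 hq.2 this.symm
  have e1 := key p1 h1 u1
  have e2 := key p2 h2 u2
  rw [Finset.mem_product] at h1 h2
  have := u1 h2.1 h2.2 (by rw [e1, e2])
  exact h12 (Prod.ext this.1.symm this.2.symm)

theorem stmt7 (p k : ℕ) (hp : p.Prime) (hk : 1 ≤ k) (lam : ℤ →₀ ZMod (p ^ k)) :
    List.TFAE
      [Function.Surjective (SCA (p ^ k) lam),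
       Function.Bijective (SCA (p ^ k) lam),
       (redSupp (p ^ k) lam).card = 1] := by
  classical
  haveI : Fact p.Prime := ⟨hp⟩
  have : Nontrivial (ZMod (p ^ k)) := by
    haveI : Fact (1 < p ^ k) := ⟨Nat.one_lt_pow (by omega) hp.one_lt⟩
    infer_instance
  have mem : ∀ i, i ∈ redSupp (p ^ k) lam ↔ IsUnit (lam i) := by
    intro i
    simp only [redSupp, Finset.mem_filter, Finsupp.mem_support_iff, and_iff_right_iff_imp]
    exact fun h => h.ne_zero
  tfae_have 2 → 1 := fun h => h.2
  tfae_have 1 → 3 := by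
    intro h
    obtain ⟨b, hb⟩ := h (1 : AddMonoidAlgebra (ZMod (p ^ k)) ℤ).coeff
    rw [SCA_eq] at hb
    have hb := AddMonoidAlgebra.coeff_injective hb
    have h2 := congrArg (AddMonoidAlgebra.mapRingHom ℤ
      (ZMod.castHom (dvd_pow_self p (by omega : k ≠ 0)) (ZMod p))) hb
    rw [map_mul, map_one] at h2
    rw [← card_of_mul_one _ _ h2]
    refine Finset.card_bij (fun i _ => -i) ?_ (fun a _ b _ h => neg_injective h) ?_
    · intro i hi
      rw [mem, (isUnit_zmod p k hp hk _).1] at hi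
      simpa [Fpoly_coeff] using hi
    · intro i hi
      refine ⟨-i, ?_, neg_neg i⟩
      rw [mem, (isUnit_zmod p k hp hk _).1]
      simpa [Fpoly_coeff] using hi
  tfae_have 3 → 2 := by
    intro h
    obtain ⟨i, hi⟩ := Finset.card_eq_one.mp h
    have hu : IsUnit (lam i) := by rw [← mem, hi]; simp
    have hU : IsUnit (Fpoly lam) := by
      rw [Fpoly, ← Finset.add_sum_erase _ _ (Finsupp.mem_support_iff.mpr hu.ne_zero)]
      refine IsNilpotent.isUnit_add_left_of_commute ?_ ?_ (Commute.all _ _)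
      · refine isNilpotent_sum fun j hj => ?_
        have hj' : ¬ IsUnit (lam j) := by
          rw [← mem, hi]
          simpa using (Finset.mem_erase.mp hj).1
        obtain ⟨n, hn⟩ := (isUnit_zmod p k hp hk _).2 hj'
        exact ⟨n, by rw [AddMonoidAlgebra.single_pow, hn, AddMonoidAlgebra.single_zero]⟩
      · obtain ⟨c, hc⟩ := hu.exists_right_inv
        refine IsUnit.of_mul_eq_one (AddMonoidAlgebra.single i c) ?_
        rw [AddMonoidAlgebra.single_mul_single, hc, AddMonoidAlgebra.one_def]
        simp
    have e : SCA (p ^ k) lam = AddMonoidAlgebra.coeff ∘ (fun x => Fpoly lam * x) ∘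
        AddMonoidAlgebra.ofCoeff := by
      funext a; exact SCA_eq lam a
    rw [e]
    refine (AddMonoidAlgebra.coeffEquiv (R := ZMod (p ^ k)) (M := ℤ)).bijective.comp
      (Function.Bijective.comp ?_ (AddMonoidAlgebra.coeffEquiv (R := ZMod (p ^ k)) (M := ℤ)).symm.bijective)
    exact IsUnit.isUnit_iff_mulLeft_bijective.mp hU
  tfae_finish
end

section
/- Let p be a prime, k ≥ 1, m = p^k, and λ : ℤ →₀ ZMod m with supp*(λ) = {s} for some s ∈ ℤ. Then S_λ is bijective, its inverse equals S_μ for some μ : ℤ →₀ ZMod m, and the p^{k−1}(p−1)-th iterate of S_λ equals the translation a ↦ (n ↦ a(n + s·p^{k−1}(p−1))), i.e. the (−s·p^{k−1}(p−1))-th power of the right shift σ. -/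
noncomputable def shiftHom (m : ℕ) :
    Multiplicative ℤ →* Module.End (ZMod m) (ℤ →₀ ZMod m) where
  toFun i := (Finsupp.domLCongr (Equiv.subRight i.toAdd) : (ℤ →₀ ZMod m) ≃ₗ[ZMod m] _).toLinearMap
  map_one' := by
    apply LinearMap.ext; intro a; ext n
    simp [Finsupp.domLCongr_apply, Finsupp.domCongr_apply, Finsupp.equivMapDomain_apply]
  map_mul' i j := by
    apply LinearMap.ext; intro a; ext n
    simp only [LinearEquiv.coe_coe, Module.End.mul_apply, Finsupp.domLCongr_apply,
      Finsupp.domCongr_apply, Finsupp.equivMapDomain_apply, Equiv.subRight_symm_apply, toAdd_mul]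
    congr 1; ring

noncomputable def actHom (m : ℕ) :
    AddMonoidAlgebra (ZMod m) ℤ →ₐ[ZMod m] Module.End (ZMod m) (ℤ →₀ ZMod m) :=
  AddMonoidAlgebra.lift _ _ _ (shiftHom m)

theorem SCA_eq_s8 (m : ℕ) (x : AddMonoidAlgebra (ZMod m) ℤ) :
    SCA m x.coeff = ⇑(actHom m x) := by
  funext a
  rw [actHom, AddMonoidAlgebra.lift_apply, SCA, Finsupp.sum, Finsupp.sum, LinearMap.sum_apply]
  rfl

theorem shiftT_eq (m : ℕ) (t : ℤ) :
    shiftT m (-t) = ⇑(actHom m (AddMonoidAlgebra.single t 1)) := by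
  funext a
  rw [actHom, AddMonoidAlgebra.lift_single, one_smul]
  ext n
  simp [shiftHom, shiftT, Finsupp.domLCongr_apply, Finsupp.domCongr_apply,
    Finsupp.equivMapDomain_apply]

theorem dvd_of_nonunit (p k : ℕ) (hp : p.Prime) (c : ZMod (p ^ k))
    (hc : ¬ IsUnit c) : (p : ZMod (p ^ k)) ∣ c := by
  have : NeZero (p ^ k) := ⟨pow_ne_zero _ hp.ne_zero⟩
  rw [← ZMod.natCast_zmod_val c] at hc ⊢
  rw [ZMod.isUnit_iff_coprime] at hc
  have : p ∣ c.val := by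
    by_contra h
    exact hc (((hp.coprime_iff_not_dvd.2 h).symm).pow_right k)
  exact Nat.cast_dvd_cast this

theorem alg_dvd (m p : ℕ) (x : AddMonoidAlgebra (ZMod m) ℤ)
    (h : ∀ i, (p : ZMod m) ∣ x.coeff i) : (p : AddMonoidAlgebra (ZMod m) ℤ) ∣ x := by
  have hx : x = ∑ i ∈ x.coeff.support, AddMonoidAlgebra.single i (x.coeff i) := by
    apply AddMonoidAlgebra.coeff_injective
    rw [AddMonoidAlgebra.coeff_sum]
    exact (Finsupp.sum_single x.coeff).symm
  rw [hx]
  refine Finset.dvd_sum fun i _ => ?_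
  obtain ⟨d, hd⟩ := h i
  refine ⟨AddMonoidAlgebra.single i d, ?_⟩
  rw [hd, ← nsmul_eq_mul, ← nsmul_eq_mul, AddMonoidAlgebra.smul_single]

theorem key (p k : ℕ) (hp : p.Prime) (hk : 1 ≤ k) (lam : ℤ →₀ ZMod (p ^ k)) (s : ℤ)
    (hs : redSupp (p ^ k) lam = {s}) :
    (AddMonoidAlgebra.ofCoeff lam) ^ (p ^ (k - 1) * (p - 1)) =
      AddMonoidAlgebra.single (s * ((p ^ (k - 1) * (p - 1) : ℕ) : ℤ)) 1 := by
  classical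
  have : Fact (1 < p ^ k) := ⟨Nat.one_lt_pow (by omega) hp.one_lt⟩
  have hu : ∀ i, IsUnit (lam i) ↔ i = s := by
    intro i
    rw [← Finset.mem_singleton, ← hs, redSupp]
    simp only [Finset.mem_filter, Finsupp.mem_support_iff]
    exact ⟨fun h => ⟨h.ne_zero, h⟩, fun h => h.2⟩
  have h1 : (p : AddMonoidAlgebra (ZMod (p ^ k)) ℤ) ∣
      AddMonoidAlgebra.ofCoeff lam - AddMonoidAlgebra.single s (lam s) := by
    apply alg_dvd
    intro i
    rw [AddMonoidAlgebra.coeff_sub, AddMonoidAlgebra.coeff_single, Finsupp.sub_apply]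
    by_cases h : i = s
    · subst h; simp
    · rw [Finsupp.single_eq_of_ne h, sub_zero]
      exact dvd_of_nonunit p k hp _ (fun h' => h ((hu i).1 h'))
  have h2 := dvd_sub_pow_of_dvd_sub h1 (k - 1)
  rw [Nat.sub_add_cancel hk] at h2
  have h3 : ((p : AddMonoidAlgebra (ZMod (p ^ k)) ℤ) ^ k) = 0 := by
    have := map_natCast (algebraMap (ZMod (p ^ k)) (AddMonoidAlgebra (ZMod (p ^ k)) ℤ)) (p ^ k)
    rw [ZMod.natCast_self, map_zero] at this
    rw [← Nat.cast_pow, ← this]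
  rw [h3, zero_dvd_iff, sub_eq_zero] at h2
  rw [pow_mul, h2, ← pow_mul, AddMonoidAlgebra.single_pow]
  obtain ⟨u, hu'⟩ := (hu s).2 rfl
  have h4 := ZMod.pow_totient u
  rw [Nat.totient_prime_pow hp hk] at h4
  rw [← hu', ← Units.val_pow_eq_pow_val, h4, nsmul_eq_mul, mul_comm, Units.val_one]

theorem stmt8 (p k : ℕ) (hp : p.Prime) (hk : 1 ≤ k) (lam : ℤ →₀ ZMod (p ^ k)) (s : ℤ)
    (hs : redSupp (p ^ k) lam = {s}) :
    Function.Bijective (SCA (p ^ k) lam) ∧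
    (∃ mu : ℤ →₀ ZMod (p ^ k),
      Function.LeftInverse (SCA (p ^ k) mu) (SCA (p ^ k) lam) ∧
      Function.RightInverse (SCA (p ^ k) mu) (SCA (p ^ k) lam)) ∧
    (SCA (p ^ k) lam)^[p ^ (k - 1) * (p - 1)]
      = shiftT (p ^ k) (-(s * ((p ^ (k - 1) * (p - 1) : ℕ) : ℤ))) := by
  have hkey := key p k hp hk lam s hs
  have hpos : p ^ (k - 1) * (p - 1) ≠ 0 :=
    mul_ne_zero (pow_ne_zero _ hp.ne_zero) (by have := hp.one_lt; omega)
  generalize p ^ (k - 1) * (p - 1) = N at *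
  have hl := SCA_eq_s8 (p ^ k) (AddMonoidAlgebra.ofCoeff lam)
  rw [AddMonoidAlgebra.coeff_ofCoeff] at hl
  have hmu : ∃ y : AddMonoidAlgebra (ZMod (p ^ k)) ℤ, y * AddMonoidAlgebra.ofCoeff lam = 1 := by
    refine ⟨AddMonoidAlgebra.single (-(s * (N : ℤ))) 1 * AddMonoidAlgebra.ofCoeff lam ^ (N - 1), ?_⟩
    rw [mul_assoc, pow_sub_one_mul hpos, hkey, AddMonoidAlgebra.single_mul_single,
      neg_add_cancel, one_mul, AddMonoidAlgebra.one_def]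
  obtain ⟨y, hy⟩ := hmu
  have hL : Function.LeftInverse (SCA (p ^ k) y.coeff) (SCA (p ^ k) lam) := by
    intro a
    rw [hl, SCA_eq_s8, ← Module.End.mul_apply, ← map_mul, hy, map_one, Module.End.one_apply]
  have hR : Function.RightInverse (SCA (p ^ k) y.coeff) (SCA (p ^ k) lam) := by
    intro a
    rw [hl, SCA_eq_s8, ← Module.End.mul_apply, ← map_mul, mul_comm, hy, map_one, Module.End.one_apply]
  refine ⟨⟨hL.injective, hR.surjective⟩, ⟨y.coeff, hL, hR⟩, ?_⟩
  rw [hl, shiftT_eq, ← hkey, map_pow, Module.End.coe_pow]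
end

section
/- Let m ≥ 1 and λ : ℤ →₀ ZMod m. Then the following are equivalent: (1) the linear cellular automaton T_λ : (ℤ → ZMod m) → (ℤ → ZMod m) is surjective; (2) for every prime p dividing m there exists i ∈ ℤ such that the image of λ(i) under the natural ring homomorphism ZMod m → ZMod p is nonzero; (3) the finitary linear cellular automaton S_λ : (ℤ →₀ ZMod m) → (ℤ →₀ ZMod m) is injective. -/
theorem aux_linearComb {R : Type*} [CommRing R] (l : ℤ →₀ R) (x : ℤ → R) (n : ℤ)
    (φ : LaurentPolynomial R →ₗ[R] R) (hx : ∀ n, x n = φ (LaurentPolynomial.T n)) :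
    φ ((l.sum fun i c => c • LaurentPolynomial.T i) * LaurentPolynomial.T n)
      = l.sum fun i c => c * x (n + i) := by
  simp only [Finsupp.sum, Finset.sum_mul, map_sum, smul_mul_assoc, map_smul, smul_eq_mul, hx,
    ← LaurentPolynomial.T_add]
  refine Finset.sum_congr rfl fun i _ => ?_
  rw [add_comm]

theorem aux_field {F : Type*} [Field F] (l : ℤ →₀ F) (hl : l ≠ 0) (y : ℤ → F) :
    ∃ x : ℤ → F, ∀ n, (l.sum fun i c => c * x (n + i)) = y n := by
  set L : LaurentPolynomial F := l.sum fun i c => c • LaurentPolynomial.T i with hLdef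
  have hT : ∀ i : ℤ, AddMonoidAlgebra.coeffLinearEquiv F (LaurentPolynomial.T i : LaurentPolynomial F)
      = Finsupp.single i 1 := fun i => rfl
  have hcoef : AddMonoidAlgebra.coeffLinearEquiv F L = l := by
    rw [hLdef, map_finsuppSum]
    conv_rhs => rw [← Finsupp.sum_single l]
    simp only [map_smul, hT, Finsupp.smul_single, smul_eq_mul, mul_one]
  have hL : L ≠ 0 := by
    intro h
    apply hl
    rw [← hcoef, h, map_zero]
  have hinj : Function.Injective (LinearMap.mulLeft F L) := fun a b h =>
    mul_left_cancel₀ hL h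
  obtain ⟨g, hg⟩ := LinearMap.exists_leftInverse_of_injective (LinearMap.mulLeft F L)
    (LinearMap.ker_eq_bot.2 hinj)
  let Y : LaurentPolynomial F →ₗ[F] F :=
    (Finsupp.linearCombination F y) ∘ₗ (AddMonoidAlgebra.coeffLinearEquiv F).toLinearMap
  refine ⟨fun n => Y (g (LaurentPolynomial.T n)), fun n => ?_⟩
  refine (aux_linearComb l _ n (Y ∘ₗ g) (fun _ => rfl)).symm.trans ?_
  have := LinearMap.congr_fun hg (LaurentPolynomial.T n)
  simp only [LinearMap.comp_apply, LinearMap.mulLeft_apply, LinearMap.id_apply] at this ⊢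
  rw [← hLdef, this]
  simp only [Y, LinearMap.comp_apply, LinearEquiv.coe_coe, hT, Finsupp.linearCombination_single, one_smul]

theorem aux_step (m : ℕ) (hm : 1 ≤ m) (lam : ℤ →₀ ZMod m) (p : ℕ) (hp : p.Prime) (hd : p ∣ m)
    (h : ∃ i : ℤ, ZMod.castHom hd (ZMod p) (lam i) ≠ 0) (y : ℤ → ZMod m) :
    ∃ x z : ℤ → ZMod m, ∀ n, y n = TCA m lam x n + (p : ZMod m) * z n := by
  haveI : Fact p.Prime := ⟨hp⟩
  haveI : NeZero m := ⟨by omega⟩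
  set f := ZMod.castHom hd (ZMod p)
  have hl : lam.mapRange f (map_zero f) ≠ 0 := by
    obtain ⟨i, hi⟩ := h
    intro h0
    apply hi
    simpa using DFunLike.congr_fun h0 i
  obtain ⟨x', hx'⟩ := aux_field _ hl (fun n => f (y n))
  choose r hr using ZMod.ringHom_surjective f
  have key : ∀ n, ∃ z : ZMod m, y n = TCA m lam (fun k => r (x' k)) n + (p : ZMod m) * z := by
    intro n
    have h1 : f (y n - TCA m lam (fun k => r (x' k)) n) = 0 := by
      rw [map_sub, ← hx' n, Finsupp.sum_mapRange_index (by simp)]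
      simp [TCA, Finsupp.sum, hr]
    set e := y n - TCA m lam (fun k => r (x' k)) n with he
    have h2 : ((e.val : ℕ) : ZMod p) = 0 := by
      rw [← h1, ← map_natCast f, ZMod.natCast_zmod_val]
    obtain ⟨c, hc⟩ := (ZMod.natCast_eq_zero_iff _ _).1 h2
    refine ⟨(c : ZMod m), ?_⟩
    have : e = (p : ZMod m) * c := by
      rw [← Nat.cast_mul, ← hc, ZMod.natCast_zmod_val]
    rw [← this, he]; ring
  choose z hz using key
  exact ⟨_, z, hz⟩

theorem aux_surj (m : ℕ) (hm : 1 ≤ m) (lam : ℤ →₀ ZMod m)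
    (h : ∀ p : ℕ, p.Prime → ∀ hd : p ∣ m, ∃ i : ℤ, ZMod.castHom hd (ZMod p) (lam i) ≠ 0) :
    Function.Surjective (TCA m lam) := by
  have key : ∀ d : ℕ, d ∣ m → ∀ y : ℤ → ZMod m,
      ∃ x z : ℤ → ZMod m, ∀ n, y n = TCA m lam x n + (d : ZMod m) * z n := by
    intro d
    induction d using induction_on_primes with
    | zero => intro h0; rw [zero_dvd_iff] at h0; omega
    | one => intro _ y; exact ⟨0, y, fun n => by simp [TCA, Finsupp.sum]⟩
    | prime_mul p a hp ih =>
      intro hd y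
      obtain ⟨x, z, hz⟩ := ih (dvd_trans (dvd_mul_left _ _) hd) y
      have hpd := dvd_trans (dvd_mul_right _ _) hd
      obtain ⟨x2, z2, hz2⟩ := aux_step m hm lam p hp hpd (h p hp hpd) z
      refine ⟨fun k => x k + a * x2 k, z2, fun n => ?_⟩
      have : TCA m lam (fun k => x k + a * x2 k) n = TCA m lam x n + a * TCA m lam x2 n := by
        simp only [TCA, Finsupp.sum, Finset.mul_sum, ← Finset.sum_add_distrib]
        exact Finset.sum_congr rfl fun i _ => by ring
      rw [this, hz, hz2]; push_cast; ring
  intro y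
  obtain ⟨x, z, hz⟩ := key m dvd_rfl y
  exact ⟨x, funext fun n => by simp [hz n]⟩

theorem aux_pair (m : ℕ) (lam a : ℤ →₀ ZMod m) (x : ℤ → ZMod m) :
    Finsupp.linearCombination (ZMod m) x (SCA m lam a)
      = a.sum fun k c => c * TCA m (Finsupp.equivMapDomain (Equiv.neg ℤ) lam) x k := by
  simp only [SCA, TCA, map_finsuppSum, map_smul, Finsupp.linearCombination_equivMapDomain,
    Finsupp.sum_equivMapDomain]
  simp only [Finsupp.linearCombination_apply, Finsupp.sum, Finset.mul_sum, Finset.smul_sum,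
    smul_eq_mul, Function.comp_apply]
  rw [Finset.sum_comm]
  refine Finset.sum_congr rfl fun i _ => Finset.sum_congr rfl fun j _ => ?_
  simp only [Equiv.subRight_apply, Equiv.neg_apply, sub_eq_add_neg]
  ring

theorem stmt10 (m : ℕ) (hm : 1 ≤ m) (lam : ℤ →₀ ZMod m) :
    List.TFAE
      [Function.Surjective (TCA m lam),
       ∀ p : ℕ, p.Prime → ∀ hd : p ∣ m,
         ∃ i : ℤ, ZMod.castHom hd (ZMod p) (lam i) ≠ 0,
       Function.Injective (SCA m lam)] := by
  haveI : NeZero m := ⟨by omega⟩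
  tfae_have 1 → 2 := by
    intro hs p hp hd
    haveI : Fact p.Prime := ⟨hp⟩
    by_contra! hc
    obtain ⟨x, hx⟩ := hs (fun _ => 1)
    have h1 := congrArg (ZMod.castHom hd (ZMod p)) (congrFun hx 0)
    simp only [TCA, Finsupp.sum, map_sum, map_mul, hc, zero_mul, Finset.sum_const_zero,
      map_one] at h1
    exact zero_ne_one h1
  tfae_have 2 → 1 := aux_surj m hm lam
  tfae_have 2 → 3 := by
    intro h a b hab
    have hs := aux_surj m hm (Finsupp.equivMapDomain (Equiv.neg ℤ) lam) (by
      intro p hp hd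
      obtain ⟨i, hi⟩ := h p hp hd
      exact ⟨-i, by simpa [Finsupp.equivMapDomain_apply] using hi⟩)
    ext k
    obtain ⟨x, hx⟩ := hs (Pi.single k 1)
    have ha := aux_pair m lam a x
    have hb := aux_pair m lam b x
    rw [hab, hb, hx] at ha
    have hs' : ∀ c : ℤ →₀ ZMod m,
        (c.sum fun j e => e * (Pi.single k 1 : ℤ → ZMod m) j) = c k := by
      intro c
      simp +contextual [Finsupp.sum, Pi.single_apply]
    rw [hs', hs'] at ha
    exact ha.symm
  tfae_have 3 → 2 := by
    intro hi p hp hd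
    by_contra! hc
    obtain ⟨q, rfl⟩ := hd
    have hq : (q : ZMod (p * q)) ≠ 0 := by
      rw [Ne, ZMod.natCast_eq_zero_iff]
      intro h
      have hq0 : 0 < q := by
        rcases Nat.eq_zero_or_pos q with h | h
        · subst h; omega
        · exact h
      have := Nat.le_of_dvd hq0 h
      have := hp.two_le
      nlinarith
    have hz : ∀ i, lam i * (q : ZMod (p * q)) = 0 := by
      intro i
      have h2 : (((lam i).val : ℕ) : ZMod p) = 0 := by
        rw [← hc i, ← map_natCast (ZMod.castHom (Dvd.intro q rfl) (ZMod p)),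
          ZMod.natCast_zmod_val]
      obtain ⟨c, hc⟩ := (ZMod.natCast_eq_zero_iff _ _).1 h2
      rw [← ZMod.natCast_zmod_val (lam i), ← Nat.cast_mul, ZMod.natCast_eq_zero_iff, hc]
      exact ⟨c, by ring⟩
    have h0 : SCA (p * q) lam (Finsupp.single 0 (q : ZMod (p * q))) = SCA (p * q) lam 0 := by
      simp [SCA, Finsupp.sum, Finsupp.equivMapDomain_single, hz]
    exact hq (by simpa using hi h0)
  tfae_finish
end

section
/- Let m ≥ 1 and λ : ℤ →₀ ZMod m. Then the following are equivalent: (1) the linear cellular automaton T_λ : (ℤ → ZMod m) → (ℤ → ZMod m) is injective; (2) T_λ is bijective; (3) T_λ is bijective and its inverse equals T_μ for some μ : ℤ →₀ ZMod m; (4) for every prime p dividing m there is exactly one i ∈ ℤ such that the image of λ(i) under the natural ring homomorphism ZMod m → ZMod p is nonzero. -/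
open AddMonoidAlgebra in
lemma aux_unit_support {R : Type*} [CommRing R] [IsDomain R] (f : AddMonoidAlgebra R ℤ)
    (hf : IsUnit f) : ∃! i : ℤ, f.coeff i ≠ 0 := by
  obtain ⟨g, hg⟩ := hf.exists_right_inv
  have hf0 : f ≠ 0 := hf.ne_zero
  have hg0 : g ≠ 0 := by
    rintro rfl
    simp at hg
  have hfs : f.coeff.support.Nonempty := by
    rw [Finsupp.support_nonempty_iff]; simpa using hf0
  have hgs : g.coeff.support.Nonempty := by
    rw [Finsupp.support_nonempty_iff]; simpa using hg0
  obtain ⟨i, hi⟩ := hfs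
  refine ⟨i, by simpa using hi, fun j hj => ?_⟩
  by_contra hne
  have hc : 1 < f.coeff.support.card * g.coeff.support.card := by
    have h1 : 1 < f.coeff.support.card :=
      Finset.one_lt_card.2 ⟨j, by simpa using hj, i, hi, hne⟩
    have h2 := hgs.card_pos
    nlinarith
  obtain ⟨p, hp, q, hq, hpq, hup, huq⟩ := TwoUniqueSums.uniqueAdd_of_one_lt_card hc
  rw [Finset.mem_product] at hp hq
  have key : ∀ p : ℤ × ℤ, p.1 ∈ f.coeff.support → p.2 ∈ g.coeff.support →
      UniqueAdd f.coeff.support g.coeff.support p.1 p.2 → p.1 + p.2 = 0 := by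
    intro p h1 h2 hu
    have := coeff_mul_add_of_uniqueAdd hu
    rw [hg, AddMonoidAlgebra.one_def, coeff_single, Finsupp.single_apply] at this
    by_contra h0
    rw [if_neg (fun h => h0 h.symm)] at this
    exact mul_ne_zero (by simpa using h1) (by simpa using h2) this.symm
  have e1 := key p hp.1 hp.2 hup
  have e2 := key q hq.1 hq.2 huq
  have := hup hq.1 hq.2 (by rw [e1, e2])
  exact hpq (Prod.ext this.1.symm this.2.symm)

/-- The shift action of `ℤ`. -/
noncomputable def auxShift (m : ℕ) :
    Multiplicative ℤ →* Module.End (ZMod m) (ℤ → ZMod m) where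
  toFun i := LinearMap.funLeft (ZMod m) (ZMod m) (fun n => n + i.toAdd)
  map_one' := by ext; simp [LinearMap.funLeft]
  map_mul' a b := by
    refine LinearMap.ext fun x => funext fun n => ?_
    simp [LinearMap.funLeft, add_assoc]

/-- The action of Laurent polynomials. -/
noncomputable def auxAct (m : ℕ) :
    AddMonoidAlgebra (ZMod m) ℤ →ₐ[ZMod m] Module.End (ZMod m) (ℤ → ZMod m) :=
  AddMonoidAlgebra.lift (ZMod m) (Module.End (ZMod m) (ℤ → ZMod m)) ℤ (auxShift m)

lemma auxAct_apply (m : ℕ) (f : AddMonoidAlgebra (ZMod m) ℤ) (x : ℤ → ZMod m) :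
    auxAct m f x = TCA m f.coeff x := by
  funext n
  simp [auxAct, AddMonoidAlgebra.lift_apply, TCA, Finsupp.sum, auxShift, LinearMap.funLeft]

lemma aux_unit_of_local (m : ℕ) (hm : 1 ≤ m) (f : AddMonoidAlgebra (ZMod m) ℤ)
    (h : ∀ p : ℕ, p.Prime → ∀ hd : p ∣ m,
         ∃! i : ℤ, ZMod.castHom hd (ZMod p) (f.coeff i) ≠ 0) : IsUnit f := by
  by_contra hu
  obtain ⟨M, hM, hfM⟩ := exists_max_ideal_of_mem_nonunits hu
  have hm0 : ((m : ℕ) : AddMonoidAlgebra (ZMod m) ℤ ⧸ M) = 0 := by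
    have h1 : ((m : ℕ) : AddMonoidAlgebra (ZMod m) ℤ) = 0 := by
      rw [← map_natCast (algebraMap (ZMod m) (AddMonoidAlgebra (ZMod m) ℤ)), ZMod.natCast_self,
        map_zero]
    rw [← map_natCast (Ideal.Quotient.mk M), h1, map_zero]
  obtain ⟨p, hp⟩ := CharP.exists (AddMonoidAlgebra (ZMod m) ℤ ⧸ M)
  have hd : p ∣ m := (CharP.cast_eq_zero_iff _ p m).1 hm0
  have hp0 : p ≠ 0 := by rintro rfl; rw [zero_dvd_iff] at hd; omega
  have hpp : p.Prime := (CharP.char_is_prime_or_zero (AddMonoidAlgebra (ZMod m) ℤ ⧸ M) p).resolve_right hp0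
  obtain ⟨i, hi, huniq⟩ := h p hpp hd
  let φ : ZMod m →+* AddMonoidAlgebra (ZMod m) ℤ ⧸ M :=
    (Ideal.Quotient.mk M).comp (algebraMap (ZMod m) (AddMonoidAlgebra (ZMod m) ℤ))
  let ψ : ZMod p →+* AddMonoidAlgebra (ZMod m) ℤ ⧸ M := ZMod.castHom dvd_rfl _
  have hφ : ∀ c, φ c = ψ (ZMod.castHom hd (ZMod p) c) := by
    intro c
    have : φ = ψ.comp (ZMod.castHom hd (ZMod p)) := Subsingleton.elim _ _
    rw [this]; rfl
  haveI := Fact.mk hpp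
  have hsingle : ∀ (j : ℤ) (c : ZMod m), Ideal.Quotient.mk M (AddMonoidAlgebra.single j c) =
      φ c * Ideal.Quotient.mk M (AddMonoidAlgebra.single j 1) := by
    intro j c
    simp only [φ, RingHom.comp_apply, ← map_mul]
    simp [AddMonoidAlgebra.single_mul_single]
  have hf : f = f.coeff.sum fun j c => AddMonoidAlgebra.single j c := by
    exact (AddMonoidAlgebra.sum_coeff_single f).symm
  have h0 : Ideal.Quotient.mk M f = 0 := Ideal.Quotient.eq_zero_iff_mem.2 hfM
  rw [hf, Finsupp.sum, map_sum, Finset.sum_eq_single i, hsingle] at h0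
  · have hT : IsUnit (Ideal.Quotient.mk M (AddMonoidAlgebra.single i (1 : ZMod m))) :=
      (LaurentPolynomial.isUnit_T (R := ZMod m) i).map _
    rw [hT.mul_left_eq_zero, hφ] at h0
    exact hi ((map_eq_zero ψ).1 h0)
  · intro j _ hji
    rw [hsingle, hφ]
    have : ZMod.castHom hd (ZMod p) (f.coeff j) = 0 := by
      by_contra hj
      exact hji (huniq j hj)
    rw [this, map_zero, zero_mul]
  · intro hi'
    rw [Finsupp.notMem_support_iff] at hi'
    exact absurd (by rw [hi', map_zero]) hi

lemma aux_embed (m p : ℕ) (hm : 1 ≤ m) (hd : p ∣ m) :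
    ∃ j : ZMod p →+ ZMod m, Function.Injective j := by
  obtain ⟨k, rfl⟩ := hd
  have hk : (k : ℤ) ≠ 0 := by
    rintro h
    have : k = 0 := by exact_mod_cast h
    subst this; simp at hm
  refine ⟨ZMod.lift p ⟨zmultiplesHom (ZMod (p * k)) (k : ZMod (p * k)), ?_⟩, ?_⟩
  · simp
    exact_mod_cast ZMod.natCast_self (p * k)
  · rw [ZMod.lift_injective]
    intro n hn
    simp at hn
    have h2 : ((n * k : ℤ) : ZMod (p * k)) = 0 := by push_cast; exact hn
    rw [ZMod.intCast_zmod_eq_zero_iff_dvd] at h2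
    push_cast at h2
    rw [ZMod.intCast_zmod_eq_zero_iff_dvd]
    exact Int.dvd_of_mul_dvd_mul_right hk h2

lemma aux_unit_of_inj (m : ℕ) (hm : 1 ≤ m) (f : AddMonoidAlgebra (ZMod m) ℤ)
    (h : Function.Injective (TCA m f.coeff)) : IsUnit f := by
  by_contra hu
  obtain ⟨M, hM, hfM⟩ := exists_max_ideal_of_mem_nonunits hu
  have hm0 : ((m : ℕ) : AddMonoidAlgebra (ZMod m) ℤ ⧸ M) = 0 := by
    have h1 : ((m : ℕ) : AddMonoidAlgebra (ZMod m) ℤ) = 0 := by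
      rw [← map_natCast (algebraMap (ZMod m) (AddMonoidAlgebra (ZMod m) ℤ)), ZMod.natCast_self,
        map_zero]
    rw [← map_natCast (Ideal.Quotient.mk M), h1, map_zero]
  obtain ⟨p, hp⟩ := CharP.exists (AddMonoidAlgebra (ZMod m) ℤ ⧸ M)
  have hd : p ∣ m := (CharP.cast_eq_zero_iff _ p m).1 hm0
  have hp0 : p ≠ 0 := by rintro rfl; rw [zero_dvd_iff] at hd; omega
  have hpp : p.Prime := (CharP.char_is_prime_or_zero (AddMonoidAlgebra (ZMod m) ℤ ⧸ M) p).resolve_right hp0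
  haveI := Fact.mk hpp
  letI : Algebra (ZMod p) (AddMonoidAlgebra (ZMod m) ℤ ⧸ M) := ZMod.algebra _ p
  obtain ⟨j, hj⟩ := aux_embed m p hm hd
  obtain ⟨d, hd1⟩ : ∃ d : Module.Dual (ZMod p) (AddMonoidAlgebra (ZMod m) ℤ ⧸ M), d 1 ≠ 0 := by
    by_contra hcon
    push Not at hcon
    exact one_ne_zero ((Module.forall_dual_apply_eq_zero_iff (ZMod p) _).1 hcon)
  let φ₀ : AddMonoidAlgebra (ZMod m) ℤ →+ ZMod m :=
    (j.comp d.toAddMonoidHom).comp (Ideal.Quotient.mk M).toAddMonoidHom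
  let φ : AddMonoidAlgebra (ZMod m) ℤ →ₗ[ZMod m] ZMod m := AddMonoidHom.toZModLinearMap m φ₀
  have hφ : ∀ y, φ y = j (d (Ideal.Quotient.mk M y)) := fun y => rfl
  let x : ℤ → ZMod m := fun n => φ (AddMonoidAlgebra.single n 1)
  have hx0 : x 0 ≠ 0 := by
    intro h0
    have h1 : φ 1 = 0 := h0
    rw [hφ, map_one, map_eq_zero_iff j hj] at h1
    exact hd1 h1
  have hTx : TCA m f.coeff x = 0 := by
    funext n
    have h1 : φ (f * AddMonoidAlgebra.single n 1) = 0 := by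
      rw [hφ, map_mul, Ideal.Quotient.eq_zero_iff_mem.2 hfM]; simp
    have hf : f = f.coeff.sum fun j c => AddMonoidAlgebra.single j c :=
      (AddMonoidAlgebra.sum_coeff_single f).symm
    rw [hf, Finsupp.sum, Finset.sum_mul, map_sum] at h1
    rw [Pi.zero_apply, ← h1]
    simp only [TCA, Finsupp.sum, x]
    refine Finset.sum_congr rfl fun i _ => ?_
    rw [AddMonoidAlgebra.single_mul_single, ← smul_eq_mul (f.coeff i), ← map_smul,
      AddMonoidAlgebra.smul_single, add_comm n i]
    simp
  have hT0 : TCA m f.coeff 0 = 0 := by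
    funext n; simp [TCA]
  have := h (hTx.trans hT0.symm)
  exact hx0 (by rw [this]; rfl)

theorem stmt11 (m : ℕ) (hm : 1 ≤ m) (lam : ℤ →₀ ZMod m) :
    List.TFAE
      [Function.Injective (TCA m lam),
       Function.Bijective (TCA m lam),
       Function.Bijective (TCA m lam) ∧
         ∃ mu : ℤ →₀ ZMod m,
           Function.LeftInverse (TCA m mu) (TCA m lam) ∧
           Function.RightInverse (TCA m mu) (TCA m lam),
       ∀ p : ℕ, p.Prime → ∀ hd : p ∣ m,
         ∃! i : ℤ, ZMod.castHom hd (ZMod p) (lam i) ≠ 0] := by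
  tfae_have 3 → 2 := fun h => h.1
  tfae_have 2 → 1 := fun h => h.1
  tfae_have 1 → 4 := by
    intro h p hp hd
    have hu := aux_unit_of_inj m hm (AddMonoidAlgebra.ofCoeff lam) h
    haveI := Fact.mk hp
    have h2 := aux_unit_support _
      (hu.map (AddMonoidAlgebra.mapRingHom ℤ (ZMod.castHom hd (ZMod p))))
    simpa using h2
  tfae_have 4 → 3 := by
    intro h
    have hu := aux_unit_of_local m hm (AddMonoidAlgebra.ofCoeff lam) h
    obtain ⟨g, hg⟩ := hu.exists_right_inv
    have hl : Function.LeftInverse (TCA m g.coeff) (TCA m lam) := by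
      intro x
      have : auxAct m (g * AddMonoidAlgebra.ofCoeff lam) x = x := by
        rw [mul_comm, hg, map_one]; rfl
      rw [map_mul, Module.End.mul_apply, auxAct_apply, auxAct_apply] at this
      exact this
    have hr : Function.RightInverse (TCA m g.coeff) (TCA m lam) := by
      intro x
      have : auxAct m (AddMonoidAlgebra.ofCoeff lam * g) x = x := by
        rw [hg, map_one]; rfl
      rw [map_mul, Module.End.mul_apply, auxAct_apply, auxAct_apply] at this
      exact this
    exact ⟨⟨hl.injective, hr.surjective⟩, g.coeff, hl, hr⟩
  tfae_finish
end

section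
/- Let p be a prime, k ≥ 1, m = p^k, and λ : ℤ →₀ ZMod m. Then h_alg(S_λ) = deg(λ)·k·log p, where deg(λ) is the degree of S_λ computed from the reduced support of λ. -/
/-- The degree of `S_lam`, computed from the reduced support:
`deg lam = max(r',0) - min(l',0)` where `l' = min supp*(lam)`, `r' = max supp*(lam)`;
`deg lam = 0` if the reduced support is empty. -/
noncomputable def degS (m : ℕ) (lam : ℤ →₀ ZMod m) : ℤ :=
  if h : (redSupp m lam).Nonempty
  then max ((redSupp m lam).max' h) 0 - min ((redSupp m lam).min' h) 0
  else 0

open scoped Pointwise in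
/-- The `n`-th trajectory of `F` under `phi`: `T_n(phi,F) = F + phi(F) + ... + phi^(n-1)(F)`
(with `T_0 = {0}`, the empty sum). -/
def Traj {G : Type*} [AddCommGroup G] (φ : G → G) (F : Set G) : ℕ → Set G
  | 0 => {0}
  | n + 1 => Traj φ F n + φ^[n] '' F

/-- The algebraic entropy of an endomorphism of an abelian group: the sup over
nonempty finite subsets `F` of `limsup (log |T_n(phi,F)|) / n`, in extended nonneg. reals. -/
noncomputable def algEntropy {G : Type*} [AddCommGroup G] (φ : G → G) : ENNReal :=
  ⨆ (F : Set G) (_ : F.Finite) (_ : F.Nonempty),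
    Filter.atTop.limsup fun n : ℕ =>
      ENNReal.ofReal (Real.log (Nat.card (Traj φ F n)) / n)

namespace EntAux

lemma SCA_apply (m : ℕ) (lam a : ℤ →₀ ZMod m) (n : ℤ) :
    SCA m lam a n = ∑ i ∈ lam.support, lam i * a (n + i) := by
  unfold SCA
  rw [Finsupp.sum, Finsupp.finsetSum_apply]
  refine Finset.sum_congr rfl fun i _ => ?_
  simp [Finsupp.equivMapDomain_apply]

/-- linear version -/
noncomputable def SL (m : ℕ) (lam : ℤ →₀ ZMod m) : Module.End (ZMod m) (ℤ →₀ ZMod m) where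
  toFun := SCA m lam
  map_add' a b := by
    ext n
    simp only [SCA_apply, Finsupp.add_apply, mul_add, Finset.sum_add_distrib]
  map_smul' c a := by
    ext n
    simp only [SCA_apply, Finsupp.smul_apply, smul_eq_mul, RingHom.id_apply, Finset.mul_sum]
    exact Finset.sum_congr rfl fun i _ => by ring

lemma SL_apply (m : ℕ) (lam a : ℤ →₀ ZMod m) (n : ℤ) :
    SL m lam a n = ∑ i ∈ lam.support, lam i * a (n + i) := SCA_apply m lam a n

lemma SL_pow (m : ℕ) (lam a : ℤ →₀ ZMod m) (n : ℕ) :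
    (SCA m lam)^[n] a = (SL m lam ^ n) a := by
  rw [Module.End.pow_apply]; rfl

section arith
variable {p k : ℕ}

lemma unit_iff (hp : p.Prime) (hk : 1 ≤ k) (x : ZMod (p ^ k)) :
    IsUnit x ↔ ¬ ((p : ZMod (p ^ k)) ∣ x) := by
  haveI : NeZero (p ^ k) := ⟨pow_ne_zero _ hp.ne_zero⟩
  constructor
  · intro hu hd
    have h := isUnit_of_dvd_unit hd hu
    rw [ZMod.isUnit_iff_coprime] at h
    have h2 : p.Coprime p := h.coprime_dvd_right (dvd_pow_self p (by omega))
    rw [Nat.coprime_self] at h2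
    exact hp.one_lt.ne' h2
  · intro h
    by_contra hu
    apply h
    rw [← ZMod.natCast_zmod_val x] at hu ⊢
    rw [ZMod.isUnit_iff_coprime] at hu
    have : p ∣ x.val := by
      by_contra hd
      exact hu ((hp.coprime_iff_not_dvd.2 hd).symm.pow_right k)
    exact Nat.cast_dvd_cast this

lemma not_dvd_mul (hp : p.Prime) (hk : 1 ≤ k) {x y : ZMod (p ^ k)}
    (hx : IsUnit x) (h : (p : ZMod (p ^ k)) ∣ x * y) : (p : ZMod (p ^ k)) ∣ y :=
  (hx.dvd_mul_left).1 h

lemma dvd_of_pow_mul (hp : p.Prime) (hk : 1 ≤ k) {j : ℕ} (hj : j < k) {x : ZMod (p ^ k)}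
    (h : (p : ZMod (p ^ k)) ^ j * x = 0) : (p : ZMod (p ^ k)) ∣ x := by
  by_contra hd
  rw [← unit_iff hp hk] at hd
  rw [hd.mul_left_eq_zero] at h
  have h' : ((p ^ j : ℕ) : ZMod (p ^ k)) = 0 := by push_cast; exact h
  rw [ZMod.natCast_eq_zero_iff] at h'
  have := (Nat.pow_dvd_pow_iff_le_right hp.one_lt).1 h'
  omega

lemma pow_k_zero : (p : ZMod (p ^ k)) ^ k = 0 := by
  have := ZMod.natCast_self (p ^ k)
  push_cast at this; exact this

lemma key (lam h : ℤ →₀ ZMod (p ^ k)) (x i0 : ℤ)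
    (hne : ∀ i, i ≠ i0 → (p : ZMod (p ^ k)) ∣ lam i * h (x + i))
    (hS : (p : ZMod (p ^ k)) ∣ SL _ lam h x) : (p : ZMod (p ^ k)) ∣ lam i0 * h (x + i0) := by
  by_cases hi : i0 ∈ lam.support
  · rw [SL_apply, ← Finset.add_sum_erase _ _ hi] at hS
    refine (dvd_add_left (Finset.dvd_sum fun i hi' => hne i (Finset.ne_of_mem_erase hi'))).1 hS
  · rw [Finsupp.notMem_support_iff.1 hi, zero_mul]; exact dvd_zero _

/-- low bound mod p is preserved when R = 0 -/
lemma low_S (lam h : ℤ →₀ ZMod (p ^ k)) (hR : ∀ i > 0, (p : ZMod (p ^ k)) ∣ lam i) (c : ℤ)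
    (hh : ∀ x < c, (p : ZMod (p ^ k)) ∣ h x) : ∀ x < c, (p : ZMod (p ^ k)) ∣ SL _ lam h x := by
  intro x hx
  rw [SL_apply]
  refine Finset.dvd_sum fun i _ => ?_
  rcases lt_or_ge 0 i with hi | hi
  · exact (hR i hi).mul_right _
  · exact (hh _ (by omega)).mul_left _

lemma high_S (lam h : ℤ →₀ ZMod (p ^ k)) (hL : ∀ i < 0, (p : ZMod (p ^ k)) ∣ lam i) (c : ℤ)
    (hh : ∀ x ≥ c, (p : ZMod (p ^ k)) ∣ h x) : ∀ x ≥ c, (p : ZMod (p ^ k)) ∣ SL _ lam h x := by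
  intro x hx
  rw [SL_apply]
  refine Finset.dvd_sum fun i _ => ?_
  rcases lt_or_ge i 0 with hi | hi
  · exact (hL i hi).mul_right _
  · exact (hh _ (by omega)).mul_left _

lemma pow_low (lam h : ℤ →₀ ZMod (p ^ k)) (hR : ∀ i > 0, (p : ZMod (p ^ k)) ∣ lam i) (c : ℤ)
    (hh : ∀ x < c, (p : ZMod (p ^ k)) ∣ h x) (n : ℕ) :
    ∀ x < c, (p : ZMod (p ^ k)) ∣ (SL _ lam ^ n) h x := by
  induction n with
  | zero => simpa using hh
  | succ n ih => rw [pow_succ']; exact low_S lam _ hR c ih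

lemma pow_high (lam h : ℤ →₀ ZMod (p ^ k)) (hL : ∀ i < 0, (p : ZMod (p ^ k)) ∣ lam i) (c : ℤ)
    (hh : ∀ x ≥ c, (p : ZMod (p ^ k)) ∣ h x) (n : ℕ) :
    ∀ x ≥ c, (p : ZMod (p ^ k)) ∣ (SL _ lam ^ n) h x := by
  induction n with
  | zero => simpa using hh
  | succ n ih => rw [pow_succ']; exact high_S lam _ hL c ih

lemma supp_bdd {m : ℕ} (h : ℤ →₀ ZMod m) : ∃ C : ℤ, 0 ≤ C ∧ ∀ x, h x ≠ 0 → -C ≤ x ∧ x ≤ C := by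
  refine ⟨∑ i ∈ h.support, |i|, Finset.sum_nonneg fun i _ => abs_nonneg i, fun x hx => ?_⟩
  exact abs_le.1 (Finset.single_le_sum (f := fun i : ℤ => |i|) (fun i _ => abs_nonneg i)
    (Finsupp.mem_support_iff.2 hx))

/-- low from unit coefficient -/
lemma low_of_S (hp : p.Prime) (hk : 1 ≤ k) (lam h : ℤ →₀ ZMod (p ^ k)) (R : ℤ)
    (hR : ∀ i > R, (p : ZMod (p ^ k)) ∣ lam i) (hu : IsUnit (lam R))
    (hh : ∀ x < 0, (p : ZMod (p ^ k)) ∣ SL _ lam h x) :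
    ∀ x < R, (p : ZMod (p ^ k)) ∣ h x := by
  by_contra hcon
  push Not at hcon
  obtain ⟨C, -, hC⟩ := supp_bdd h
  obtain ⟨b, ⟨hb1, hb2⟩, hb3⟩ := Int.exists_least_of_bdd
    (P := fun x => x < R ∧ ¬ (p : ZMod (p ^ k)) ∣ h x)
    ⟨-C, fun z hz => (hC z (fun h0 => hz.2 (h0 ▸ dvd_zero _))).1⟩ hcon
  have := key lam h (b - R) R (fun i hi => by
    rcases lt_or_gt_of_ne hi with hi | hi
    · refine Dvd.dvd.mul_left ?_ _
      by_contra hnd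
      have := hb3 _ ⟨by omega, hnd⟩
      omega
    · exact (hR i hi).mul_right _) (hh _ (by omega))
  rw [sub_add_cancel] at this
  exact hb2 (not_dvd_mul hp hk hu this)

lemma high_of_S (hp : p.Prime) (hk : 1 ≤ k) (lam h : ℤ →₀ ZMod (p ^ k)) (L d : ℤ)
    (hL : ∀ i < -L, (p : ZMod (p ^ k)) ∣ lam i) (hu : IsUnit (lam (-L)))
    (hh : ∀ x ≥ d, (p : ZMod (p ^ k)) ∣ SL _ lam h x) :
    ∀ x ≥ d - L, (p : ZMod (p ^ k)) ∣ h x := by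
  by_contra hcon
  push Not at hcon
  obtain ⟨C, -, hC⟩ := supp_bdd h
  obtain ⟨b, ⟨hb1, hb2⟩, hb3⟩ := Int.exists_greatest_of_bdd
    (P := fun x => x ≥ d - L ∧ ¬ (p : ZMod (p ^ k)) ∣ h x)
    ⟨C, fun z hz => (hC z (fun h0 => hz.2 (h0 ▸ dvd_zero _))).2⟩ hcon
  have := key lam h (b + L) (-L) (fun i hi => by
    rcases lt_or_gt_of_ne hi with hi | hi
    · exact (hL i hi).mul_right _
    · refine Dvd.dvd.mul_left ?_ _
      by_contra hnd
      have := hb3 _ ⟨by omega, hnd⟩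
      omega) (hh _ (by omega))
  rw [add_neg_cancel_right] at this
  exact hb2 (not_dvd_mul hp hk hu this)

/-- the data R, L -/
structure Ends (lam : ℤ →₀ ZMod (p ^ k)) (R L : ℤ) : Prop where
  R0 : 0 ≤ R
  L0 : 0 ≤ L
  hR : ∀ i > R, (p : ZMod (p ^ k)) ∣ lam i
  hL : ∀ i < -L, (p : ZMod (p ^ k)) ∣ lam i
  uR : R = 0 ∨ IsUnit (lam R)
  uL : L = 0 ∨ IsUnit (lam (-L))

lemma inj_mod (hp : p.Prime) (hk : 1 ≤ k) (lam : ℤ →₀ ZMod (p ^ k)) (R L : ℤ)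
    (E : Ends lam R L) (n : ℕ) : ∀ (f : ℕ → ℤ →₀ ZMod (p ^ k))
    (_ : ∀ i x, (x < 0 ∨ x ≥ R + L) → f i x = 0)
    (_ : ∀ x, (p : ZMod (p ^ k)) ∣ (∑ i ∈ Finset.range n, (SL _ lam ^ i) (f i)) x),
    ∀ i < n, ∀ x, (p : ZMod (p ^ k)) ∣ f i x := by
  induction n with
  | zero => intro f _ _ i hi; omega
  | succ n ih =>
    intro f hf hs
    set h := ∑ i ∈ Finset.range n, (SL _ lam ^ i) (f (i + 1)) with hh
    have hsum : ∑ i ∈ Finset.range (n + 1), (SL _ lam ^ i) (f i) = SL _ lam h + f 0 := by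
      rw [Finset.sum_range_succ', hh, map_sum]
      simp [pow_succ']
    rw [hsum] at hs
    have hS : ∀ x, (x < 0 ∨ x ≥ R + L) → (p : ZMod (p ^ k)) ∣ SL _ lam h x := by
      intro x hx
      have := hs x
      rwa [Finsupp.add_apply, hf 0 x hx, add_zero] at this
    have hlow : ∀ x < R, (p : ZMod (p ^ k)) ∣ h x := by
      rcases E.uR with h0 | hu
      · intro x hx
        rw [hh, Finsupp.finsetSum_apply]
        refine Finset.dvd_sum fun i _ => pow_low lam _ (h0 ▸ E.hR) R (fun y hy => ?_) i x hx
        rw [hf _ _ (by omega)]; exact dvd_zero _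
      · exact low_of_S hp hk lam h R E.hR hu fun x hx => hS x (Or.inl hx)
    have hhigh : ∀ x ≥ R + L - L, (p : ZMod (p ^ k)) ∣ h x := by
      rcases E.uL with h0 | hu
      · intro x hx
        rw [hh, Finsupp.finsetSum_apply]
        have := E.hL
        rw [h0, neg_zero] at this
        refine Finset.dvd_sum fun i _ => pow_high lam _ this R (fun y hy => ?_) i x (by omega)
        rw [hf _ _ (by omega)]; exact dvd_zero _
      · exact high_of_S hp hk lam h L (R + L) E.hL hu fun x hx => hS x (Or.inr hx)
    have hall : ∀ x, (p : ZMod (p ^ k)) ∣ h x := fun x => by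
      rcases lt_or_ge x R with hx | hx
      · exact hlow x hx
      · exact hhigh x (by omega)
    intro i hi x
    rcases i with _ | i
    · refine (dvd_add_right ?_).1 (hs x)
      rw [SL_apply]
      exact Finset.dvd_sum fun i _ => (hall _).mul_left _
    · exact ih (fun i => f (i + 1)) (fun i => hf (i + 1)) hall i (by omega) x

lemma inj_pow (hp : p.Prime) (hk : 1 ≤ k) (lam : ℤ →₀ ZMod (p ^ k)) (R L : ℤ)
    (E : Ends lam R L) (n : ℕ) (f : ℕ → ℤ →₀ ZMod (p ^ k))
    (hf : ∀ i x, (x < 0 ∨ x ≥ R + L) → f i x = 0)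
    (hs : ∑ i ∈ Finset.range n, (SL _ lam ^ i) (f i) = 0) (j : ℕ) (hj : j ≤ k) :
    ∃ g : ℕ → ℤ →₀ ZMod (p ^ k), (∀ i x, (x < 0 ∨ x ≥ R + L) → g i x = 0) ∧
      ∀ i < n, f i = (p : ZMod (p ^ k)) ^ j • g i := by
  induction j with
  | zero => exact ⟨f, hf, by simp⟩
  | succ j ih =>
    obtain ⟨g, hg, hfg⟩ := ih (by omega)
    have h1 : (p : ZMod (p ^ k)) ^ j • ∑ i ∈ Finset.range n, (SL _ lam ^ i) (g i) = 0 := by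
      rw [← hs, Finset.smul_sum]
      refine Finset.sum_congr rfl fun i hi => ?_
      rw [hfg i (Finset.mem_range.1 hi), map_smul]
    have h2 := inj_mod hp hk lam R L E n g hg (fun x => by
      refine dvd_of_pow_mul hp hk (j := j) (by omega) ?_
      have := DFunLike.congr_fun h1 x
      simpa using this)
    have h3 : ∀ y : ZMod (p ^ k), ∃ z, (p : ZMod (p ^ k)) ∣ y → (y = p * z ∧ (y = 0 → z = 0)) := by
      intro y
      by_cases hy : y = 0
      · exact ⟨0, fun _ => by simp [hy]⟩
      · by_cases hd : (p : ZMod (p ^ k)) ∣ y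
        · obtain ⟨z, hz⟩ := hd
          exact ⟨z, fun _ => ⟨hz, fun h => absurd h hy⟩⟩
        · exact ⟨0, fun h => absurd h hd⟩
    choose q hq using h3
    have q0 : q 0 = 0 := (hq 0 (dvd_zero _)).2 rfl
    refine ⟨fun i => (g i).mapRange q q0, fun i x hx => by simp [hg i x hx, q0], fun i hi => ?_⟩
    rw [hfg i hi]
    ext x
    have := (hq _ (h2 i hi x)).1
    simp only [Finsupp.smul_apply, Finsupp.mapRange_apply, smul_eq_mul, pow_succ, mul_assoc]
    rw [← this]

lemma inj_full (hp : p.Prime) (hk : 1 ≤ k) (lam : ℤ →₀ ZMod (p ^ k)) (R L : ℤ)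
    (E : Ends lam R L) (n : ℕ) (f : ℕ → ℤ →₀ ZMod (p ^ k))
    (hf : ∀ i x, (x < 0 ∨ x ≥ R + L) → f i x = 0)
    (hs : ∑ i ∈ Finset.range n, (SL _ lam ^ i) (f i) = 0) : ∀ i < n, f i = 0 := by
  obtain ⟨g, -, h⟩ := inj_pow hp hk lam R L E n f hf hs k le_rfl
  intro i hi
  rw [h i hi, pow_k_zero, zero_smul]

/-- upper bound on supports -/
lemma up_low (lam f : ℤ →₀ ZMod (p ^ k)) (R C c : ℤ) (hC0 : 0 ≤ C)
    (hR : ∀ i > R, (p : ZMod (p ^ k)) ∣ lam i) (hR0 : 0 ≤ R) (hC : ∀ i > C, lam i = 0)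
    (hf : ∀ x < c, f x = 0) (n : ℕ) : ∀ (j : ℕ) (x : ℤ), x < c - R * n - j * C →
      (p : ZMod (p ^ k)) ^ j ∣ (SL _ lam ^ n) f x := by
  induction n with
  | zero =>
    intro j x hx
    have : 0 ≤ (j : ℤ) * C := by positivity
    simp only [pow_zero, Module.End.one_apply]
    rw [hf x (by push_cast at hx; linarith)]; exact dvd_zero _
  | succ n ih =>
    intro j x hx
    rw [pow_succ', Module.End.mul_apply, SL_apply]
    push_cast at hx
    refine Finset.dvd_sum fun i _ => ?_
    rcases le_or_gt i R with hi | hi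
    · exact (ih j _ (by linarith)).mul_left _
    · rcases le_or_gt i C with hi' | hi'
      · rcases j with _ | j
        · simp
        · rw [pow_succ']
          refine mul_dvd_mul (hR i hi) (ih j _ ?_)
          push_cast at hx; linarith
      · rw [hC i hi', zero_mul]; exact dvd_zero _

lemma up_high (lam f : ℤ →₀ ZMod (p ^ k)) (L C c : ℤ) (hC0 : 0 ≤ C)
    (hL : ∀ i < -L, (p : ZMod (p ^ k)) ∣ lam i) (hL0 : 0 ≤ L) (hC : ∀ i < -C, lam i = 0)
    (hf : ∀ x > c, f x = 0) (n : ℕ) : ∀ (j : ℕ) (x : ℤ), x > c + L * n + j * C →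
      (p : ZMod (p ^ k)) ^ j ∣ (SL _ lam ^ n) f x := by
  induction n with
  | zero =>
    intro j x hx
    have : 0 ≤ (j : ℤ) * C := by positivity
    simp only [pow_zero, Module.End.one_apply]
    rw [hf x (by push_cast at hx; linarith)]; exact dvd_zero _
  | succ n ih =>
    intro j x hx
    rw [pow_succ', Module.End.mul_apply, SL_apply]
    push_cast at hx
    refine Finset.dvd_sum fun i _ => ?_
    rcases le_or_gt (-L) i with hi | hi
    · exact (ih j _ (by linarith)).mul_left _
    · rcases le_or_gt (-C) i with hi' | hi'
      · rcases j with _ | j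
        · simp
        · rw [pow_succ']
          refine mul_dvd_mul (hL i hi) (ih j _ ?_)
          push_cast at hx; linarith
      · rw [hC i hi', zero_mul]; exact dvd_zero _

lemma exists_ends (hp : p.Prime) (hk : 1 ≤ k) (lam : ℤ →₀ ZMod (p ^ k)) :
    ∃ R L : ℤ, Ends lam R L ∧ degS (p ^ k) lam = R + L := by
  classical
  haveI : Fact (1 < p ^ k) := ⟨Nat.one_lt_pow (by omega) hp.one_lt⟩
  have hmem : ∀ i, i ∈ redSupp (p ^ k) lam ↔ IsUnit (lam i) := by
    intro i
    simp only [redSupp, Finset.mem_filter, Finsupp.mem_support_iff]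
    exact ⟨fun h => h.2, fun h => ⟨h.ne_zero, h⟩⟩
  have hd : ∀ i, i ∉ redSupp (p ^ k) lam → (p : ZMod (p ^ k)) ∣ lam i := by
    intro i hi
    rw [hmem, unit_iff hp hk, not_not] at hi; exact hi
  by_cases h : (redSupp (p ^ k) lam).Nonempty
  · refine ⟨max ((redSupp _ lam).max' h) 0, -min ((redSupp _ lam).min' h) 0, ?_, ?_⟩
    · refine ⟨le_max_right _ _, by simp, ?_, ?_, ?_, ?_⟩
      · intro i hi
        refine hd i fun hm => ?_
        have := Finset.le_max' _ _ hm
        omega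
      · intro i hi
        refine hd i fun hm => ?_
        have := Finset.min'_le _ _ hm
        omega
      · rcases le_total ((redSupp _ lam).max' h) 0 with h0 | h0
        · left; simpa using h0
        · right; rw [max_eq_left h0, ← hmem]; exact Finset.max'_mem _ _
      · rcases le_total 0 ((redSupp _ lam).min' h) with h0 | h0
        · left; simpa using h0
        · right; rw [neg_neg, min_eq_left h0, ← hmem]; exact Finset.min'_mem _ _
    · rw [degS, dif_pos h]; ring
  · refine ⟨0, 0, ⟨le_rfl, le_rfl, ?_, ?_, Or.inl rfl, Or.inl rfl⟩, by rw [degS, dif_neg h]; rfl⟩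
    all_goals
      intro i _
      exact hd i fun hm => h ⟨i, hm⟩

end arith

lemma card_window (m : ℕ) [NeZero m] (s : Finset ℤ) :
    Nat.card (Finsupp.supported (ZMod m) (ZMod m) (s : Set ℤ)) = m ^ s.card := by
  rw [Nat.card_congr (Finsupp.supportedEquivFinsupp (R := ZMod m) (M := ZMod m) (s : Set ℤ)).toEquiv,
    Nat.card_congr (Finsupp.equivFunOnFinite), Nat.card_fun]
  simp

lemma finite_window (m : ℕ) [NeZero m] (s : Finset ℤ) :
    Finite (Finsupp.supported (ZMod m) (ZMod m) (s : Set ℤ)) := by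
  apply Nat.finite_of_card_ne_zero
  rw [card_window]
  exact pow_ne_zero _ (NeZero.ne m)

lemma traj_sub {G : Type*} [AddCommGroup G] (φ : G → G) (F : Set G) (W : AddSubgroup G) (n : ℕ)
    (h : ∀ i < n, ∀ f ∈ F, φ^[i] f ∈ W) : Traj φ F n ⊆ W := by
  induction n with
  | zero => intro x hx; rw [Traj, Set.mem_singleton_iff] at hx; rw [hx]; exact W.zero_mem
  | succ n ih =>
    rw [Traj]
    rintro _ ⟨a, ha, _, ⟨f, hf, rfl⟩, rfl⟩
    exact W.add_mem (ih (fun i hi => h i (by omega)) ha) (h n (by omega) f hf)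

lemma sum_mem_traj {G : Type*} [AddCommGroup G] (φ : G → G) (F : Set G) (f : ℕ → G)
    (hf : ∀ i, f i ∈ F) (n : ℕ) : ∑ i ∈ Finset.range n, φ^[i] (f i) ∈ Traj φ F n := by
  induction n with
  | zero => simp [Traj]
  | succ n ih =>
    rw [Finset.sum_range_succ, Traj]
    exact Set.add_mem_add ih ⟨_, hf n, rfl⟩

lemma upper (p k : ℕ) (hp : p.Prime) (lam : ℤ →₀ ZMod (p ^ k)) (R L : ℤ)
    (E : Ends lam R L) (F : Set (ℤ →₀ ZMod (p ^ k))) (hF : F.Finite) :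
    ∃ e : ℕ, ∀ n : ℕ, Nat.card (Traj (SCA (p ^ k) lam) F n)
      ≤ (p ^ k) ^ ((R + L).toNat * n + e) := by
  haveI : NeZero (p ^ k) := ⟨pow_ne_zero _ hp.ne_zero⟩
  obtain ⟨C, hC0, hC⟩ := supp_bdd lam
  have hD : ∃ D : ℤ, 0 ≤ D ∧ ∀ f ∈ F, ∀ x, f x ≠ 0 → -D ≤ x ∧ x ≤ D := by
    choose c hc0 hc using fun h : ℤ →₀ ZMod (p ^ k) => supp_bdd h
    refine ⟨∑ f ∈ hF.toFinset, c f, Finset.sum_nonneg fun f _ => hc0 f, fun f hf x hx => ?_⟩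
    have h1 := hc f x hx
    have h2 := Finset.single_le_sum (f := c) (fun i _ => hc0 i) (hF.mem_toFinset.2 hf)
    omega
  obtain ⟨D, hD0, hD⟩ := hD
  refine ⟨(2 * D + 2 * (k * C) + 1).toNat, fun n => ?_⟩
  have hR0 := E.R0
  have hL0 := E.L0
  have hkC : 0 ≤ (k : ℤ) * C := by positivity
  have hRn : 0 ≤ R * n := by positivity
  have hLn : 0 ≤ L * n := by positivity
  set s := Finset.Icc (-D - R * n - k * C) (D + L * n + k * C) with hs
  have hcard : s.card = (R + L).toNat * n + (2 * D + 2 * (k * C) + 1).toNat := by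
    rw [hs, Int.card_Icc]
    zify
    rw [Int.toNat_of_nonneg (by linarith), Int.toNat_of_nonneg (by linarith),
      Int.toNat_of_nonneg (by linarith)]
    ring
  haveI := finite_window (p ^ k) s
  rw [← hcard, ← card_window]
  have hsub : Traj (SCA (p ^ k) lam) F n ⊆
      (Finsupp.supported (ZMod (p ^ k)) (ZMod (p ^ k)) (s : Set ℤ)).toAddSubgroup := by
    refine traj_sub _ _ _ _ fun i hi f hf => ?_
    rw [SL_pow]
    change _ ∈ Finsupp.supported (ZMod (p ^ k)) (ZMod (p ^ k)) (s : Set ℤ)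
    rw [Finsupp.mem_supported']
    intro x hx
    rw [hs, Finset.mem_coe, Finset.mem_Icc, not_and_or, not_le, not_le] at hx
    have hin : (i : ℤ) ≤ n := by exact_mod_cast hi.le
    have h1 := mul_le_mul_of_nonneg_left hin hR0
    have h2 := mul_le_mul_of_nonneg_left hin hL0
    rw [← zero_dvd_iff, ← pow_k_zero (p := p) (k := k)]
    rcases hx with hx | hx
    · refine up_low lam f R C (-D) hC0 E.hR hR0 (fun y hy => ?_) (fun y hy => ?_) i k x (by linarith)
      · by_contra h0; have := hC y h0; omega
      · by_contra h0; have := hD f hf y h0; omega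
    · refine up_high lam f L C D hC0 E.hL hL0 (fun y hy => ?_) (fun y hy => ?_) i k x (by linarith)
      · by_contra h0; have := hC y h0; omega
      · by_contra h0; have := hD f hf y h0; omega
  exact Nat.card_le_card_of_injective (Set.inclusion hsub) (Set.inclusion_injective hsub)

lemma lower (p k : ℕ) (hp : p.Prime) (hk : 1 ≤ k) (lam : ℤ →₀ ZMod (p ^ k)) (R L : ℤ)
    (E : Ends lam R L) : ∃ F : Set (ℤ →₀ ZMod (p ^ k)), F.Finite ∧ F.Nonempty ∧
    ∀ n : ℕ, (p ^ k) ^ ((R + L).toNat * n) ≤ Nat.card (Traj (SCA (p ^ k) lam) F n) := by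
  haveI : NeZero (p ^ k) := ⟨pow_ne_zero _ hp.ne_zero⟩
  set s := Finset.Ico 0 (R + L) with hs
  set W := Finsupp.supported (ZMod (p ^ k)) (ZMod (p ^ k)) (s : Set ℤ) with hW
  haveI : Finite W := finite_window (p ^ k) s
  have hfin : (W : Set (ℤ →₀ ZMod (p ^ k))).Finite := Set.toFinite _
  have hz : ∀ f ∈ W, ∀ x, (x < 0 ∨ x ≥ R + L) → f x = 0 := by
    intro f hf x hx
    rw [hW, Finsupp.mem_supported'] at hf
    refine hf x ?_
    rw [hs, Finset.mem_coe, Finset.mem_Ico]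
    omega
  refine ⟨W, hfin, ⟨0, W.zero_mem⟩, fun n => ?_⟩
  have hcard : (p ^ k) ^ ((R + L).toNat * n) = Nat.card (Fin n → W) := by
    rw [Nat.card_fun, Nat.card_fin, hW, card_window, hs, Int.card_Ico, sub_zero, pow_mul]
  rw [hcard]
  obtain ⟨e, he⟩ := upper p k hp lam R L E W hfin
  let ext : (Fin n → W) → ℕ → ℤ →₀ ZMod (p ^ k) := fun f i => if h : i < n then (f ⟨i, h⟩ : _) else 0
  have hext : ∀ f i, ext f i ∈ W := by
    intro f i
    by_cases h : i < n
    · simp only [ext, dif_pos h]; exact (f ⟨i, h⟩).2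
    · simp only [ext, dif_neg h]; exact W.zero_mem
  have hTfin : Finite (Traj (SCA (p ^ k) lam) (W : Set _) n) := by
    have : ∀ n, (Traj (SCA (p ^ k) lam) (W : Set _) n).Finite := by
      intro n
      induction n with
      | zero => exact Set.finite_singleton _
      | succ n ih => rw [Traj]; exact ih.add (hfin.image _)
    exact this n
  refine Nat.card_le_card_of_injective
    (fun f => (⟨_, sum_mem_traj (SCA (p ^ k) lam) W (ext f) (hext f) n⟩ : Traj _ _ n)) ?_
  intro f g hfg
  have h := congrArg Subtype.val hfg
  simp only [SL_pow] at h
  have h2 := inj_full hp hk lam R L E n (fun i => ext f i - ext g i)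
    (fun i x hx => hz _ (W.sub_mem (hext f i) (hext g i)) x hx)
    (by simp only [map_sub, Finset.sum_sub_distrib]; exact sub_eq_zero.2 h)
  funext i
  have h3 := sub_eq_zero.1 (h2 i i.2)
  simp only [ext, dif_pos i.2] at h3
  exact Subtype.ext h3

end EntAux

open EntAux in
theorem stmt15 (p k : ℕ) (hp : p.Prime) (hk : 1 ≤ k) (lam : ℤ →₀ ZMod (p ^ k)) :
    algEntropy (SCA (p ^ k) lam)
      = ENNReal.ofReal ((degS (p ^ k) lam : ℝ) * ((k : ℝ) * Real.log p)) := by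
  obtain ⟨R, L, E, hdeg⟩ := exists_ends hp hk lam
  have hd0 : 0 ≤ R + L := add_nonneg E.R0 E.L0
  set d := (R + L).toNat with hd
  have hdd : ((degS (p ^ k) lam : ℤ) : ℝ) = (d : ℝ) := by
    rw [hdeg]
    have : ((d : ℤ)) = R + L := Int.toNat_of_nonneg hd0
    rw [← this]; simp
  rw [hdd]
  have hlog : ∀ N : ℕ, Real.log (((p ^ k) ^ N : ℕ) : ℝ) = N * (k * Real.log p) := by
    intro N; push_cast; rw [Real.log_pow, Real.log_pow]
  have hpos : ∀ N : ℕ, (0 : ℝ) < (((p ^ k) ^ N : ℕ) : ℝ) := by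
    intro N; exact_mod_cast pow_pos (pow_pos hp.pos _) _
  have hlp : 0 ≤ (k : ℝ) * Real.log p :=
    mul_nonneg (Nat.cast_nonneg _) (Real.log_natCast_nonneg _)
  apply le_antisymm
  · refine iSup_le fun F => iSup_le fun hF => iSup_le fun _ => ?_
    obtain ⟨e, he⟩ := upper p k hp lam R L E F hF
    have hlim : Filter.Tendsto (fun n : ℕ => ENNReal.ofReal
        (d * (k * Real.log p) + (e * (k * Real.log p)) / (n : ℝ))) Filter.atTop
        (nhds (ENNReal.ofReal (d * (k * Real.log p)))) := by
      apply ENNReal.tendsto_ofReal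
      simpa using (tendsto_const_nhds (x := (d : ℝ) * (k * Real.log p))).add
        (tendsto_const_div_atTop_nhds_zero_nat ((e : ℝ) * (k * Real.log p)))
    rw [← hlim.limsup_eq]
    refine Filter.limsup_le_limsup ?_
    filter_upwards [Filter.eventually_gt_atTop 0] with n hn
    apply ENNReal.ofReal_le_ofReal
    have hn' : (0 : ℝ) < n := by exact_mod_cast hn
    have h1 : Real.log (Nat.card (Traj (SCA (p ^ k) lam) F n)) ≤
        ((d * n + e : ℕ) : ℝ) * (k * Real.log p) := by
      rw [← hlog]
      rcases Nat.eq_zero_or_pos (Nat.card (Traj (SCA (p ^ k) lam) F n)) with h0 | h0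
      · rw [h0, hlog]; simp only [Nat.cast_zero, Real.log_zero]; positivity
      · exact Real.log_le_log (by exact_mod_cast h0) (by exact_mod_cast he n)
    rw [div_le_iff₀ hn']
    refine h1.trans (le_of_eq ?_)
    push_cast
    field_simp
  · obtain ⟨F, hF, hne, h⟩ := lower p k hp hk lam R L E
    refine le_trans ?_ (le_iSup_of_le F (le_iSup_of_le hF (le_iSup_of_le hne le_rfl)))
    rw [← Filter.limsup_const (f := (Filter.atTop : Filter ℕ))
      (ENNReal.ofReal ((d : ℝ) * ((k : ℝ) * Real.log p)))]
    refine Filter.limsup_le_limsup ?_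
    filter_upwards [Filter.eventually_gt_atTop 0] with n hn
    apply ENNReal.ofReal_le_ofReal
    have hn' : (0 : ℝ) < n := by exact_mod_cast hn
    rw [le_div_iff₀ hn']
    have h1 := Real.log_le_log (hpos _) (Nat.cast_le (α := ℝ).2 (h n))
    rw [hlog] at h1
    refine le_trans (le_of_eq ?_) h1
    push_cast
    ring
end

section
/- Let m ≥ 1 and λ : ℤ →₀ ZMod m. Then the topological entropy of the continuous map T_λ on the compact space ℤ → ZMod m (product topology, ZMod m discrete) equals ∑_{p prime, p ∣ m} deg_p(λ)·k_p·log p, where k_p is the multiplicity of p in the prime factorization of m. -/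
/-- `supp_p(lam) = {i : the image of lam i in ZMod p is nonzero}`. -/
noncomputable def suppP (m p : ℕ) (hd : p ∣ m) (lam : ℤ →₀ ZMod m) : Finset ℤ :=
  letI := Classical.decPred fun i : ℤ => ZMod.castHom hd (ZMod p) (lam i) ≠ 0
  lam.support.filter fun i => ZMod.castHom hd (ZMod p) (lam i) ≠ 0

/-- `deg_p(lam) = max(r,0) - min(l,0)` where `l = min supp_p(lam)`, `r = max supp_p(lam)`;
`deg_p(lam) = 0` if `supp_p(lam)` is empty. -/
noncomputable def degP (m p : ℕ) (hd : p ∣ m) (lam : ℤ →₀ ZMod m) : ℤ :=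
  if h : (suppP m p hd lam).Nonempty
  then max ((suppP m p hd lam).max' h) 0 - min ((suppP m p hd lam).min' h) 0
  else 0

noncomputable def TL (m : ℕ) (lam : ℤ →₀ ZMod m) : (ℤ → ZMod m) →ₗ[ZMod m] (ℤ → ZMod m) where
  toFun := TCA m lam
  map_add' x y := by
    funext n
    simp only [TCA, Finsupp.sum, Pi.add_apply, mul_add, Finset.sum_add_distrib]
  map_smul' c x := by
    funext n
    simp only [TCA, Finsupp.sum, Pi.smul_apply, smul_eq_mul, Finset.mul_sum, RingHom.id_apply]
    exact Finset.sum_congr rfl fun i _ => by ring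

theorem TL_apply (m : ℕ) (lam : ℤ →₀ ZMod m) (x : ℤ → ZMod m) (n : ℤ) :
    TL m lam x n = ∑ i ∈ lam.support, lam i * x (n + i) := rfl

theorem TCA_iter (m : ℕ) (lam : ℤ →₀ ZMod m) (j : ℕ) (x : ℤ → ZMod m) :
    (TCA m lam)^[j] x = (TL m lam ^ j) x := by
  rw [Module.End.pow_apply]; rfl

theorem cast_zero_iff (m d : ℕ) (hm : 1 ≤ m) (hd : d ∣ m) (a : ZMod m) :
    ZMod.castHom hd (ZMod d) a = 0 ↔ (d : ZMod m) ∣ a := by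
  have : NeZero m := ⟨by omega⟩
  constructor
  · intro h
    rw [← ZMod.natCast_zmod_val a] at h ⊢
    rw [map_natCast, ZMod.natCast_eq_zero_iff] at h
    exact Nat.cast_dvd_cast h
  · rintro ⟨b, rfl⟩
    rw [map_mul, map_natCast, ZMod.natCast_self, zero_mul]

theorem mem_suppP (m p : ℕ) (hm : 1 ≤ m) (hd : p ∣ m) (lam : ℤ →₀ ZMod m) (i : ℤ) :
    i ∈ suppP m p hd lam ↔ ¬ (p : ZMod m) ∣ lam i := by
  unfold suppP
  rw [← cast_zero_iff m p hm hd]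
  refine (@Finset.mem_filter _ _ (Classical.decPred _) _ _).trans ?_
  constructor
  · exact fun h => h.2
  · intro h
    refine ⟨?_, h⟩
    rw [Finsupp.mem_support_iff]
    intro h0
    exact h (by rw [h0, map_zero])

theorem exists_lr (m p : ℕ) (hm : 1 ≤ m) (hd : p ∣ m) (lam : ℤ →₀ ZMod m) :
    ∃ l r : ℤ, l ≤ 0 ∧ 0 ≤ r ∧ degP m p hd lam = r - l ∧
      (∀ i, ¬ (p : ZMod m) ∣ lam i → l ≤ i ∧ i ≤ r) ∧
      (0 < r → ¬ (p : ZMod m) ∣ lam r) ∧ (l < 0 → ¬ (p : ZMod m) ∣ lam l) := by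
  by_cases h : (suppP m p hd lam).Nonempty
  · refine ⟨min ((suppP m p hd lam).min' h) 0, max ((suppP m p hd lam).max' h) 0,
      min_le_right _ _, le_max_right _ _, ?_, ?_, ?_, ?_⟩
    · simp only [degP, h, dif_pos]
    · intro i hi
      rw [← mem_suppP m p hm hd] at hi
      exact ⟨(min_le_left _ _).trans (Finset.min'_le _ _ hi),
        (Finset.le_max' _ _ hi).trans (le_max_left _ _)⟩
    · intro h0
      have : max ((suppP m p hd lam).max' h) 0 = (suppP m p hd lam).max' h := by
        rcases lt_max_iff.1 h0 with h1 | h1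
        · exact max_eq_left h1.le
        · exact absurd h1 (lt_irrefl _)
      rw [this, ← mem_suppP m p hm hd]
      exact Finset.max'_mem _ _
    · intro h0
      have : min ((suppP m p hd lam).min' h) 0 = (suppP m p hd lam).min' h := by
        rcases min_lt_iff.1 h0 with h1 | h1
        · exact min_eq_left h1.le
        · exact absurd h1 (lt_irrefl _)
      rw [this, ← mem_suppP m p hm hd]
      exact Finset.min'_mem _ _
  · refine ⟨0, 0, le_rfl, le_rfl, by simp [degP, h], ?_, fun h => absurd h (lt_irrefl _),
      fun h => absurd h (lt_irrefl _)⟩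
    intro i hi
    rw [← mem_suppP m p hm hd] at hi
    exact absurd ⟨i, hi⟩ h

/-- Upper bound: propagation of vanishing. -/
theorem upper_prop (m p : ℕ) (lam : ℤ →₀ ZMod m) (l r B : ℤ) (hl : l ≤ 0) (hr : 0 ≤ r)
    (hlr : ∀ i, ¬ (p : ZMod m) ∣ lam i → l ≤ i ∧ i ≤ r)
    (hB : 0 ≤ B) (hBs : ∀ i ∈ lam.support, -B ≤ i ∧ i ≤ B) (a b : ℤ) (k : ℕ) (x : ℤ → ZMod m)
    (hx : ∀ w, a ≤ w → w ≤ b → (p : ZMod m) ^ k ∣ x w) (j : ℕ) :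
    ∀ i ≤ k, ∀ w : ℤ, a - j * l + i * B ≤ w → w ≤ b - j * r - i * B →
      (p : ZMod m) ^ i ∣ (TL m lam ^ j) x w := by
  induction j with
  | zero =>
    intro i hi w h1 h2
    have : 0 ≤ (i : ℤ) * B := by positivity
    push_cast at h1 h2
    simp only [pow_zero, Module.End.one_apply]
    exact (pow_dvd_pow _ hi).trans (hx w (by linarith) (by linarith))
  | succ j ih =>
    intro i hi w h1 h2
    push_cast at h1 h2
    rw [pow_succ', Module.End.mul_apply, TL_apply]
    apply Finset.dvd_sum
    intro s hs
    obtain ⟨hs1, hs2⟩ := hBs s hs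
    by_cases hp : (p : ZMod m) ∣ lam s
    · rcases i with _ | i
      · simp
      · rw [pow_succ']
        push_cast at h1 h2
        exact mul_dvd_mul hp (ih i (by omega) _ (by linarith) (by linarith))
    · obtain ⟨h3, h4⟩ := hlr s hp
      exact Dvd.dvd.mul_left (ih i hi _ (by linarith) (by linarith)) _

theorem high_prop (m p : ℕ) (lam : ℤ →₀ ZMod m) (r : ℤ)
    (hr : ∀ i, ¬ (p : ZMod m) ∣ lam i → i ≤ r) (y : ℤ → ZMod m) (c : ℤ)
    (hy : ∀ w < c, (p : ZMod m) ∣ y w) (n : ℕ) :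
    (∀ w < c - n * r, (p : ZMod m) ∣ (TL m lam ^ n) y w) ∧
      (p : ZMod m) ∣ (TL m lam ^ n) y (c - n * r) - lam r ^ n * y c := by
  induction n with
  | zero => simpa using hy
  | succ n ih =>
    obtain ⟨ih1, ih2⟩ := ih
    have key : ∀ w ≤ c - (n + 1) * r, (p : ZMod m) ∣
        (TL m lam ^ (n + 1)) y w - lam r * (TL m lam ^ n) y (w + r) := by
      intro w hw
      rw [pow_succ', Module.End.mul_apply, TL_apply]
      by_cases hrs : r ∈ lam.support
      · rw [← Finset.add_sum_erase _ _ hrs, add_sub_cancel_left]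
        apply Finset.dvd_sum
        intro s hs
        by_cases hp : (p : ZMod m) ∣ lam s
        · exact hp.mul_right _
        · have h1 := hr s hp
          have h2 := Finset.ne_of_mem_erase hs
          have : s < r := lt_of_le_of_ne h1 h2
          exact (ih1 _ (by linarith)).mul_left _
      · rw [Finsupp.notMem_support_iff.1 hrs, zero_mul, sub_zero]
        apply Finset.dvd_sum
        intro s hs
        by_cases hp : (p : ZMod m) ∣ lam s
        · exact hp.mul_right _
        · have h1 := hr s hp
          have : s < r := lt_of_le_of_ne h1 (by rintro rfl; exact hrs hs)
          exact (ih1 _ (by linarith)).mul_left _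
    push_cast
    constructor
    · intro w hw
      have h1 := key w hw.le
      have h2 := (ih1 (w + r) (by linarith)).mul_left (lam r)
      simpa using dvd_add h1 h2
    · have h1 := key _ le_rfl
      rw [show c - ((n : ℤ) + 1) * r + r = c - n * r by ring] at h1
      have h2 := dvd_add h1 (ih2.mul_left (lam r))
      convert h2 using 1
      ring

theorem low_prop (m p : ℕ) (lam : ℤ →₀ ZMod m) (r : ℤ)
    (hr : ∀ i, ¬ (p : ZMod m) ∣ lam i → r ≤ i) (y : ℤ → ZMod m) (c : ℤ)
    (hy : ∀ w > c, (p : ZMod m) ∣ y w) (n : ℕ) :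
    (∀ w > c - n * r, (p : ZMod m) ∣ (TL m lam ^ n) y w) ∧
      (p : ZMod m) ∣ (TL m lam ^ n) y (c - n * r) - lam r ^ n * y c := by
  induction n with
  | zero => simpa using hy
  | succ n ih =>
    obtain ⟨ih1, ih2⟩ := ih
    have key : ∀ w ≥ c - (n + 1) * r, (p : ZMod m) ∣
        (TL m lam ^ (n + 1)) y w - lam r * (TL m lam ^ n) y (w + r) := by
      intro w hw
      rw [pow_succ', Module.End.mul_apply, TL_apply]
      by_cases hrs : r ∈ lam.support
      · rw [← Finset.add_sum_erase _ _ hrs, add_sub_cancel_left]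
        apply Finset.dvd_sum
        intro s hs
        by_cases hp : (p : ZMod m) ∣ lam s
        · exact hp.mul_right _
        · have h1 := hr s hp
          have h2 := Finset.ne_of_mem_erase hs
          have : r < s := lt_of_le_of_ne h1 h2.symm
          exact (ih1 _ (by linarith)).mul_left _
      · rw [Finsupp.notMem_support_iff.1 hrs, zero_mul, sub_zero]
        apply Finset.dvd_sum
        intro s hs
        by_cases hp : (p : ZMod m) ∣ lam s
        · exact hp.mul_right _
        · have h1 := hr s hp
          have : r < s := lt_of_le_of_ne h1 (by rintro rfl; exact hrs hs)
          exact (ih1 _ (by linarith)).mul_left _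
    push_cast
    constructor
    · intro w hw
      have h1 := key w hw.le
      have h2 := (ih1 (w + r) (by linarith)).mul_left (lam r)
      simpa using dvd_add h1 h2
    · have h1 := key _ le_rfl
      rw [show c - ((n : ℤ) + 1) * r + r = c - n * r by ring] at h1
      have h2 := dvd_add h1 (ih2.mul_left (lam r))
      convert h2 using 1
      ring

/-- Every target can be matched mod `q` on the index set `A`. -/
def Matched (m : ℕ) (q : ZMod m) (lam : ℤ →₀ ZMod m) (A : Set (ℕ × ℤ)) : Prop :=
  ∀ t : ℕ × ℤ → ZMod m, ∃ x : ℤ → ZMod m, ∀ z ∈ A, q ∣ (TL m lam ^ z.1) x z.2 - t z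

theorem Matched.mono {m : ℕ} {q : ZMod m} {lam : ℤ →₀ ZMod m} {A A' : Set (ℕ × ℤ)}
    (h : Matched m q lam A) (hA : A' ⊆ A) : Matched m q lam A' := fun t => by
  obtain ⟨x, hx⟩ := h t
  exact ⟨x, fun z hz => hx z (hA hz)⟩

theorem Matched.insert {m : ℕ} {q : ZMod m} {lam : ℤ →₀ ZMod m} {A : Set (ℕ × ℤ)}
    (h : Matched m q lam A) (z₀ : ℕ × ℤ) (y : ℤ → ZMod m)
    (hy : ∀ z ∈ A, q ∣ (TL m lam ^ z.1) y z.2) (u : ZMod m)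
    (hu : q ∣ u * (TL m lam ^ z₀.1) y z₀.2 - 1) : Matched m q lam (insert z₀ A) := by
  intro t
  obtain ⟨x, hx⟩ := h t
  refine ⟨x + ((t z₀ - (TL m lam ^ z₀.1) x z₀.2) * u) • y, ?_⟩
  intro z hz
  rw [map_add, map_smul, Pi.add_apply, Pi.smul_apply, smul_eq_mul]
  rcases Set.mem_insert_iff.1 hz with rfl | hz
  · have := hu.mul_left (t z - (TL m lam ^ z.1) x z.2)
    convert this using 1
    ring
  · have := dvd_add (hx z hz) ((hy z hz).mul_left ((t z₀ - (TL m lam ^ z₀.1) x z₀.2) * u))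
    convert this using 1
    ring

theorem inv_mod (m p : ℕ) (hm : 1 ≤ m) (hp : p.Prime) (hd : p ∣ m) (a : ZMod m)
    (ha : ¬ (p : ZMod m) ∣ a) (n : ℕ) : ∃ u, (p : ZMod m) ∣ u * a ^ n - 1 := by
  have : NeZero m := ⟨by omega⟩
  have : Fact p.Prime := ⟨hp⟩
  rw [← cast_zero_iff m p hm hd] at ha
  obtain ⟨u, hu⟩ := ZMod.castHom_surjective hd ((ZMod.castHom hd (ZMod p) a ^ n)⁻¹)
  refine ⟨u, ?_⟩
  rw [← cast_zero_iff m p hm hd, map_sub, map_mul, map_pow, hu, map_one,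
    inv_mul_cancel₀ (pow_ne_zero _ ha), sub_self]

theorem matched_prime (m p : ℕ) (hm : 1 ≤ m) (hp : p.Prime) (hd : p ∣ m) (lam : ℤ →₀ ZMod m)
    (l r : ℤ) (hl : l ≤ 0) (hr : 0 ≤ r)
    (hlr : ∀ i, ¬ (p : ZMod m) ∣ lam i → l ≤ i ∧ i ≤ r)
    (hr' : 0 < r → ¬ (p : ZMod m) ∣ lam r) (hl' : l < 0 → ¬ (p : ZMod m) ∣ lam l) (n : ℕ) :
    Matched m p lam {z | z.1 < n ∧ 0 ≤ z.2 ∧ z.2 < r - l} := by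
  induction n with
  | zero => exact fun t => ⟨0, fun z hz => absurd hz.1 (Nat.not_lt_zero _)⟩
  | succ n ih =>
    have high : ∀ i : ℕ, (i : ℤ) ≤ r → Matched m p lam
        ({z | z.1 < n ∧ 0 ≤ z.2 ∧ z.2 < r - l} ∪ {z | z.1 = n ∧ -l ≤ z.2 ∧ z.2 < -l + i}) := by
      intro i
      induction i with
      | zero =>
        intro _
        refine ih.mono ?_
        rintro z (hz | hz)
        · exact hz
        · simp only [Set.mem_ofPred_eq, Nat.cast_zero] at hz; omega
      | succ i ihi =>
        intro hi
        push_cast at hi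
        obtain ⟨u, hu⟩ := inv_mod m p hm hp hd (lam r) (hr' (by omega)) n
        have hy : ∀ w < n * r + (-l + i), (p : ZMod m) ∣
            (Pi.single (n * r + (-l + i)) 1 : ℤ → ZMod m) w := by
          intro w hw
          rw [Pi.single_eq_of_ne hw.ne]; exact dvd_zero _
        have H := high_prop m p lam r (fun i hi => (hlr i hi).2) _ _ hy
        refine ((ihi (by omega)).insert (n, -l + i) (Pi.single (n * r + (-l + i)) 1) ?_ u
          ?_).mono ?_
        · rintro ⟨j, w⟩ (⟨h1, h2, h3⟩ | ⟨h1, h2, h3⟩)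
          · refine (H j).1 w ?_
            dsimp only at h1 h2 h3
            have : 0 ≤ ((n : ℤ) - j - 1) * r := mul_nonneg (by omega) hr
            nlinarith
          · dsimp only at h1 h2 h3
            subst h1
            exact (H j).1 w (by linarith)
        · have h2 := (H n).2
          rw [Pi.single_eq_same, mul_one, add_sub_cancel_left] at h2
          have := dvd_add (h2.mul_left u) hu
          convert this using 1
          ring
        · rintro ⟨j, w⟩ (h | ⟨h1, h2, h3⟩)
          · exact Or.inr (Or.inl h)
          · dsimp only at h1 h2 h3
            push_cast at h3
            subst h1
            by_cases h : w = -l + i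
            · left; rw [h]
            · right; right; exact ⟨rfl, h2, by dsimp only; omega⟩
    have low : ∀ i : ℕ, (i : ℤ) ≤ -l → Matched m p lam
        ({z | z.1 < n ∧ 0 ≤ z.2 ∧ z.2 < r - l} ∪ {z | z.1 = n ∧ -l - i ≤ z.2 ∧ z.2 < r - l}) := by
      intro i
      induction i with
      | zero =>
        intro _
        refine (high r.toNat (by omega)).mono ?_
        rintro z (hz | hz)
        · exact Or.inl hz
        · right
          simp only [Set.mem_ofPred_eq, Nat.cast_zero] at hz ⊢; omega
      | succ i ihi =>
        intro hi
        push_cast at hi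
        obtain ⟨u, hu⟩ := inv_mod m p hm hp hd (lam l) (hl' (by omega)) n
        have hy : ∀ w > n * l + (-l - i - 1), (p : ZMod m) ∣
            (Pi.single (n * l + (-l - i - 1)) 1 : ℤ → ZMod m) w := by
          intro w hw
          rw [Pi.single_eq_of_ne hw.ne']; exact dvd_zero _
        have H := low_prop m p lam l (fun i hi => (hlr i hi).1) _ _ hy
        refine ((ihi (by omega)).insert (n, -l - i - 1) (Pi.single (n * l + (-l - i - 1)) 1) ?_ u
          ?_).mono ?_
        · rintro ⟨j, w⟩ (⟨h1, h2, h3⟩ | ⟨h1, h2, h3⟩)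
          · refine (H j).1 w ?_
            dsimp only at h1 h2 h3
            have : 0 ≤ ((n : ℤ) - j - 1) * (-l) := mul_nonneg (by omega) (by omega)
            nlinarith
          · dsimp only at h1 h2 h3
            subst h1
            exact (H j).1 w (by linarith)
        · have h2 := (H n).2
          rw [Pi.single_eq_same, mul_one, add_sub_cancel_left] at h2
          have := dvd_add (h2.mul_left u) hu
          convert this using 1
          ring
        · rintro ⟨j, w⟩ (h | ⟨h1, h2, h3⟩)
          · exact Or.inr (Or.inl h)
          · dsimp only at h1 h2 h3
            push_cast at h2
            subst h1
            by_cases h : w = -l - i - 1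
            · left; rw [h]
            · right; right; exact ⟨rfl, by dsimp only; omega, h3⟩
    refine (low (-l).toNat (by omega)).mono ?_
    rintro ⟨j, w⟩ ⟨h1, h2, h3⟩
    dsimp only at h1 h2 h3
    by_cases h : j < n
    · exact Or.inl ⟨h, h2, h3⟩
    · exact Or.inr ⟨by dsimp only; omega, by dsimp only; omega, h3⟩

theorem Matched.pow {m : ℕ} {q : ZMod m} {lam : ℤ →₀ ZMod m} {A : Set (ℕ × ℤ)}
    (h : Matched m q lam A) (k : ℕ) : Matched m (q ^ k) lam A := by
  induction k with
  | zero => exact fun t => ⟨0, fun z _ => by simp⟩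
  | succ k ih =>
    intro t
    obtain ⟨x, hx⟩ := ih t
    choose! s hs using hx
    obtain ⟨y, hy⟩ := h (-s)
    refine ⟨x + q ^ k • y, fun z hz => ?_⟩
    rw [map_add, map_smul, Pi.add_apply, Pi.smul_apply, smul_eq_mul, pow_succ]
    have h1 := mul_dvd_mul_left (q ^ k) (hy z hz)
    convert h1 using 1
    have h2 := hs z hz
    rw [Pi.neg_apply]
    linear_combination h2

theorem eq_zero_of_dvd (m : ℕ) (hm : 1 ≤ m) (a : ZMod m)
    (h : ∀ p ∈ m.primeFactors, (p : ZMod m) ^ m.factorization p ∣ a) : a = 0 := by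
  have : NeZero m := ⟨by omega⟩
  have key : m ∣ a.val := by
    rw [Nat.dvd_iff_prime_pow_dvd_dvd]
    intro p k hp hk
    rcases Nat.eq_zero_or_pos k with rfl | hk0
    · simp
    have hpm : p ∣ m := (dvd_pow_self p hk0.ne').trans hk
    have hmem : p ∈ m.primeFactors := Nat.mem_primeFactors.2 ⟨hp, hpm, by omega⟩
    have h1 := h p hmem
    have hle : k ≤ m.factorization p := (hp.pow_dvd_iff_le_factorization (by omega)).1 hk
    have h2 : ((p ^ k : ℕ) : ZMod m) ∣ a := by
      push_cast
      exact (pow_dvd_pow _ hle).trans h1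
    rw [← cast_zero_iff m (p ^ k) hm hk, ← ZMod.natCast_zmod_val a, map_natCast,
      ZMod.natCast_eq_zero_iff] at h2
    exact h2
  rw [← ZMod.natCast_zmod_val a, ZMod.natCast_eq_zero_iff]
  exact key

theorem ca_exists_idem (m : ℕ) (hm : 1 ≤ m) (p : ℕ) (hp : p ∈ m.primeFactors) :
    ∃ e : ZMod m, (p : ZMod m) ^ m.factorization p ∣ e - 1 ∧
      ∀ q ∈ m.primeFactors, q ≠ p → (q : ZMod m) ^ m.factorization q ∣ e := by
  have hpp := Nat.prime_of_mem_primeFactors hp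
  have hco : Nat.Coprime (p ^ m.factorization p) (m / p ^ m.factorization p) :=
    (Nat.coprime_ordCompl hpp (by omega)).pow_left _
  have h1 : IsCoprime ((p ^ m.factorization p : ℕ) : ZMod m)
      ((m / p ^ m.factorization p : ℕ) : ZMod m) := by
    have := (Nat.isCoprime_iff_coprime.2 hco).map (Int.castRingHom (ZMod m))
    rw [eq_intCast, eq_intCast, Int.cast_natCast, Int.cast_natCast] at this
    exact this
  obtain ⟨a, b, hab⟩ := h1
  refine ⟨b * ((m / p ^ m.factorization p : ℕ) : ZMod m), ?_, ?_⟩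
  · refine ⟨-a, ?_⟩
    push_cast at hab ⊢
    linear_combination hab
  · intro q hq hne
    have hqq := Nat.prime_of_mem_primeFactors hq
    apply Dvd.dvd.mul_left
    have h2 : q ^ m.factorization q ∣ m / p ^ m.factorization p := by
      apply Nat.Coprime.dvd_of_dvd_mul_left (m := p ^ m.factorization p)
      · exact ((Nat.coprime_primes hqq hpp).2 hne).pow _ _
      · rw [Nat.ordProj_mul_ordCompl_eq_self]
        exact Nat.ordProj_dvd m q
    have h3 := Nat.cast_dvd_cast (α := ZMod m) h2
    rwa [Nat.cast_pow] at h3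

noncomputable def dP (m : ℕ) (lam : ℤ →₀ ZMod m) (p : {p // p ∈ m.primeFactors}) : ℕ :=
  (degP m p.1 (Nat.dvd_of_mem_primeFactors p.2) lam).toNat

theorem degP_eq (m : ℕ) (hm : 1 ≤ m) (lam : ℤ →₀ ZMod m) (p : {p // p ∈ m.primeFactors}) :
    degP m p.1 (Nat.dvd_of_mem_primeFactors p.2) lam = dP m lam p := by
  obtain ⟨l, r, hl, hr, h, -⟩ := exists_lr m p.1 hm (Nat.dvd_of_mem_primeFactors p.2) lam
  unfold dP
  omega

theorem match_all (m : ℕ) (hm : 1 ≤ m) (lam : ℤ →₀ ZMod m) (n : ℕ)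
    (t : {p // p ∈ m.primeFactors} → ℕ × ℤ → ZMod m) :
    ∃ x : ℤ → ZMod m, ∀ p : {p // p ∈ m.primeFactors}, ∀ j < n, ∀ w : ℤ, 0 ≤ w → w < dP m lam p →
      (p.1 : ZMod m) ^ m.factorization p.1 ∣ (TL m lam ^ j) x w - t p (j, w) := by
  classical
  have h1 : ∀ p : {p // p ∈ m.primeFactors}, ∃ x : ℤ → ZMod m,
      ∀ j < n, ∀ w : ℤ, 0 ≤ w → w < dP m lam p →
      (p.1 : ZMod m) ^ m.factorization p.1 ∣ (TL m lam ^ j) x w - t p (j, w) := by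
    intro p
    have hdp := degP_eq m hm lam p
    obtain ⟨l, r, hl, hr, h, h2, h3, h4⟩ :=
      exists_lr m p.1 hm (Nat.dvd_of_mem_primeFactors p.2) lam
    obtain ⟨x, hx⟩ := (matched_prime m p.1 hm (Nat.prime_of_mem_primeFactors p.2)
      (Nat.dvd_of_mem_primeFactors p.2) lam l r hl hr h2 h3 h4 n).pow (m.factorization p.1) (t p)
    exact ⟨x, fun j hj w hw0 hw => hx (j, w) ⟨hj, hw0, by dsimp only; omega⟩⟩
  choose x hx using h1
  choose e he1 he2 using fun p : {p // p ∈ m.primeFactors} => ca_exists_idem m hm p.1 p.2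
  refine ⟨∑ p, e p • x p, ?_⟩
  intro p j hj w hw0 hw
  rw [map_sum, Finset.sum_apply, ← Finset.add_sum_erase _ _ (Finset.mem_univ p)]
  have hA : (p.1 : ZMod m) ^ m.factorization p.1 ∣
      ∑ q ∈ Finset.univ.erase p, (TL m lam ^ j) (e q • x q) w := by
    apply Finset.dvd_sum
    intro q hq
    rw [map_smul, Pi.smul_apply, smul_eq_mul]
    exact (he2 q p.1 p.2 (fun h => Finset.ne_of_mem_erase hq (Subtype.ext h.symm))).mul_right _
  rw [map_smul, Pi.smul_apply, smul_eq_mul]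
  have := dvd_add (dvd_add hA (hx p j hj w hw0 hw)) ((he1 p).mul_right ((TL m lam ^ j) (x p) w))
  convert this using 1
  ring

/-- The basic entourages. -/
def UN (m : ℕ) (N : ℕ) : SetRel (ℤ → ZMod m) (ℤ → ZMod m) :=
  {z | ∀ i : ℤ, -N ≤ i → i ≤ N → z.1 i = z.2 i}

theorem UN_mem (m : ℕ) [UniformSpace (ZMod m)] [DiscreteUniformity (ZMod m)] (N : ℕ) :
    UN m N ∈ uniformity (ℤ → ZMod m) := by
  have h : ∀ i : ℤ, {z : (ℤ → ZMod m) × (ℤ → ZMod m) | z.1 i = z.2 i} ∈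
      uniformity (ℤ → ZMod m) := by
    intro i
    have h1 := Pi.uniformContinuous_proj (fun _ : ℤ => ZMod m) i
    have h2 : (SetRel.id : SetRel (ZMod m) (ZMod m)) ∈ uniformity (ZMod m) := by
      rw [DiscreteUniformity.eq_principal_setRelId]
      exact Filter.mem_principal_self _
    exact h1 h2
  have h2 := (Filter.biInter_finset_mem (Finset.Icc (-N : ℤ) N)).2 fun i _ => h i
  refine Filter.mem_of_superset h2 ?_
  intro z hz i hi1 hi2
  simp only [Set.mem_iInter] at hz
  exact hz i (Finset.mem_Icc.2 ⟨hi1, hi2⟩)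

theorem exists_UN (m : ℕ) [UniformSpace (ZMod m)] [DiscreteUniformity (ZMod m)]
    (U : SetRel (ℤ → ZMod m) (ℤ → ZMod m)) (hU : U ∈ uniformity (ℤ → ZMod m)) :
    ∃ N, UN m N ⊆ U := by
  rw [Pi.uniformity, Filter.mem_iInf] at hU
  obtain ⟨I, hI, V, hV, rfl⟩ := hU
  refine ⟨hI.toFinset.sup Int.natAbs, ?_⟩
  intro z hz
  rw [Set.mem_iInter]
  intro i
  have h1 := hV i
  rw [DiscreteUniformity.eq_principal_setRelId, Filter.comap_principal,
    Filter.mem_principal] at h1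
  apply h1
  have h2 : Int.natAbs i.1 ≤ hI.toFinset.sup Int.natAbs :=
    Finset.le_sup (f := Int.natAbs) (hI.mem_toFinset.2 i.2)
  exact hz i.1 (by omega) (by omega)

theorem cover_of_map {X Q : Type*} [Nonempty X] [Finite Q] (T : X → X) (U : SetRel X X) (n : ℕ)
    (q : X → Q) (hq : ∀ x y, q x = q y → ∀ j < n, (T^[j] x, T^[j] y) ∈ U) :
    Dynamics.coverMincard T Set.univ U n ≤ (Nat.card Q : ℕ∞) := by
  classical
  have := Fintype.ofFinite Q
  have hc : Dynamics.IsDynCoverOf T Set.univ U n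
      ((Finset.univ.image (Function.invFun q) : Finset X) : Set X) := by
    intro x _
    refine ⟨Function.invFun q (q x), by simp, ?_⟩
    show (x, _) ∈ Dynamics.dynEntourage T U n
    rw [Dynamics.mem_dynEntourage]
    exact hq _ _ (Function.invFun_eq ⟨x, rfl⟩).symm
  refine hc.coverMincard_le_card.trans ?_
  rw [Nat.card_eq_fintype_card]
  exact_mod_cast Finset.card_image_le

theorem le_cover_of_map {X Q : Type*} (T : X → X) (U : SetRel X X) (n : ℕ)
    (q : X → Q) (hs : Function.Surjective q)
    (hq : ∀ x y, (∀ j < n, (T^[j] x, T^[j] y) ∈ U) → q x = q y) :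
    (Nat.card Q : ℕ∞) ≤ Dynamics.coverMincard T Set.univ U n := by
  refine le_iInf₂ fun s hc => ?_
  have h1 : Function.Surjective fun y : s => q y.1 := by
    intro c
    obtain ⟨x, rfl⟩ := hs c
    obtain ⟨y, hy, hxy⟩ := hc (Set.mem_univ x)
    refine ⟨⟨y, hy⟩, (hq x y ?_).symm⟩
    exact Dynamics.mem_dynEntourage.1 hxy
  have h2 := Nat.card_le_card_of_surjective _ h1
  rw [Nat.card_eq_fintype_card (α := s), Fintype.card_coe] at h2
  exact_mod_cast h2

theorem pk_dvd (m p : ℕ) : p ^ m.factorization p ∣ m := Nat.ordProj_dvd m p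

noncomputable def bP (m : ℕ) (lam : ℤ →₀ ZMod m) : ℕ :=
  ∏ p : {p // p ∈ m.primeFactors}, (p.1 ^ m.factorization p.1) ^ dP m lam p

theorem lower_bound (m : ℕ) (hm : 1 ≤ m) (lam : ℤ →₀ ZMod m) (N : ℕ)
    (hN : ∀ p, dP m lam p ≤ N) (n : ℕ) :
    ((bP m lam ^ n : ℕ) : ℕ∞) ≤ Dynamics.coverMincard (TCA m lam) Set.univ (UN m N) n := by
  let Q := ∀ p : {p // p ∈ m.primeFactors},
    (Fin n × Fin (dP m lam p)) → ZMod (p.1 ^ m.factorization p.1)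
  have hcard : Nat.card Q = bP m lam ^ n := by
    simp only [Q, Nat.card_pi, Nat.card_fun, Nat.card_zmod, Nat.card_prod, Nat.card_fin, bP,
      ← Finset.prod_pow]
    refine Finset.prod_congr rfl fun p _ => ?_
    simp only [Finset.prod_const, Finset.card_univ, Fintype.card_prod, Fintype.card_fin]
    rw [← pow_mul, ← pow_mul, ← pow_mul]
    ring
  rw [← hcard]
  refine le_cover_of_map (Q := Q) _ _ _ (fun x p z =>
    ZMod.castHom (pk_dvd m p.1) (ZMod (p.1 ^ m.factorization p.1))
      ((TCA m lam)^[z.1] x (z.2 : ℤ))) ?_ ?_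
  · intro c
    have hsur := fun p : {p // p ∈ m.primeFactors} =>
      ZMod.castHom_surjective (pk_dvd m p.1)
    choose f hf using hsur
    obtain ⟨x, hx⟩ := match_all m hm lam n (fun p z =>
      if h : z.1 < n ∧ z.2.toNat < dP m lam p then f p (c p (⟨z.1, h.1⟩, ⟨z.2.toNat, h.2⟩)) else 0)
    refine ⟨x, ?_⟩
    funext p z
    obtain ⟨⟨j, hj⟩, ⟨w, hw⟩⟩ := z
    have h1 := hx p j hj w (by omega) (by omega)
    rw [dif_pos ⟨hj, by simpa using hw⟩, ← Nat.cast_pow, ← cast_zero_iff m _ hm (pk_dvd m p.1),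
      map_sub, hf, sub_eq_zero] at h1
    dsimp only
    rw [TCA_iter, h1]
    simp
  · intro x y h
    funext p z
    have h1 := h z.1 z.1.2 (z.2 : ℤ) (by omega) (by have := hN p; have := z.2.2; omega)
    dsimp only at h1 ⊢
    rw [h1]

theorem upper_bound (m : ℕ) (hm : 1 ≤ m) (lam : ℤ →₀ ZMod m) (N : ℕ) :
    ∃ C : ℕ, ∀ n, Dynamics.coverMincard (TCA m lam) Set.univ (UN m N) n ≤
      ((C * bP m lam ^ n : ℕ) : ℕ∞) := by
  have hne : ∀ p : {p // p ∈ m.primeFactors}, NeZero (p.1 ^ m.factorization p.1) := fun p =>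
    ⟨pow_ne_zero _ (Nat.prime_of_mem_primeFactors p.2).ne_zero⟩
  let B : ℕ := lam.support.sup Int.natAbs
  let c : {p // p ∈ m.primeFactors} → ℕ := fun p => 2 * (m.factorization p.1 * B) + 2 * N + 1
  refine ⟨∏ p : {p // p ∈ m.primeFactors}, (p.1 ^ m.factorization p.1) ^ c p, fun n => ?_⟩
  have hlr := fun p : {p // p ∈ m.primeFactors} =>
    exists_lr m p.1 hm (Nat.dvd_of_mem_primeFactors p.2) lam
  choose l r hl hr hd hs _ _ using hlr
  let Q := ∀ p : {p // p ∈ m.primeFactors},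
    Fin (c p + n * dP m lam p) → ZMod (p.1 ^ m.factorization p.1)
  have hcard : Nat.card Q = (∏ p : {p // p ∈ m.primeFactors},
      (p.1 ^ m.factorization p.1) ^ c p) * bP m lam ^ n := by
    simp only [Q, Nat.card_pi, Nat.card_fun, Nat.card_zmod, Nat.card_fin, bP,
      ← Finset.prod_pow, ← Finset.prod_mul_distrib]
    refine Finset.prod_congr rfl fun p _ => ?_
    simp only [Finset.prod_const, Finset.card_univ, Fintype.card_fin]
    rw [pow_add, ← pow_mul _ (dP m lam p) n, mul_comm n]
  rw [← hcard]
  refine cover_of_map (Q := Q) _ _ _ (fun x p z =>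
    ZMod.castHom (pk_dvd m p.1) (ZMod (p.1 ^ m.factorization p.1))
      (x (n * l p - m.factorization p.1 * B - N + z))) ?_
  intro x y hxy j hj i hi1 hi2
  dsimp only
  rw [TCA_iter, TCA_iter, ← sub_eq_zero, ← Pi.sub_apply, ← map_sub]
  apply eq_zero_of_dvd m hm
  intro p hp
  have hdeg := degP_eq m hm lam ⟨p, hp⟩
  rw [hd] at hdeg
  refine upper_prop m p lam (l ⟨p, hp⟩) (r ⟨p, hp⟩) B (hl _) (hr _) (hs ⟨p, hp⟩) (by positivity) ?_
    (n * l ⟨p, hp⟩ - m.factorization p * B - N) (n * r ⟨p, hp⟩ + m.factorization p * B + N)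
    (m.factorization p) (x - y) ?_ j _ le_rfl i ?_ ?_
  · intro s hs
    have : Int.natAbs s ≤ B := Finset.le_sup (f := Int.natAbs) hs
    omega
  · intro w hw1 hw2
    have h1 := congrFun (congrFun hxy ⟨p, hp⟩)
      ⟨(w - (n * l ⟨p, hp⟩ - m.factorization p * B - N)).toNat, ?_⟩
    · dsimp only at h1
      rw [Int.toNat_of_nonneg (by linarith), add_sub_cancel, ← sub_eq_zero, ← map_sub,
        cast_zero_iff m _ hm, Nat.cast_pow] at h1
      exact h1
    · rw [Int.toNat_lt (by linarith)]
      dsimp only [c]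
      push_cast
      rw [← hdeg]
      linarith
  · have : 0 ≤ ((n : ℤ) - j) * (- l ⟨p, hp⟩) := mul_nonneg (by omega) (by have := hl ⟨p, hp⟩; omega)
    linarith
  · have : 0 ≤ ((n : ℤ) - j) * (r ⟨p, hp⟩) := mul_nonneg (by omega) (hr _)
    linarith

theorem bP_pos (m : ℕ) (lam : ℤ →₀ ZMod m) : 0 < bP m lam :=
  Finset.prod_pos fun p _ => pow_pos (pow_pos (Nat.prime_of_mem_primeFactors p.2).pos _) _

theorem entropy_eq (m : ℕ) (hm : 1 ≤ m) (lam : ℤ →₀ ZMod m)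
    [UniformSpace (ZMod m)] [DiscreteUniformity (ZMod m)] :
    Dynamics.coverEntropy (TCA m lam) Set.univ = ENNReal.log (bP m lam : ENNReal) := by
  apply le_antisymm
  · refine iSup₂_le fun U hU => ?_
    obtain ⟨N, hN⟩ := exists_UN m U hU
    refine (Dynamics.coverEntropyEntourage_antitone _ _ hN).trans ?_
    obtain ⟨C, hC⟩ := upper_bound m hm lam N
    rw [← ExpGrowth.expGrowthSup_pow]
    refine ExpGrowth.expGrowthSup_le_of_eventually_le (b := (C : ENNReal)) (by simp)
      (Filter.Eventually.of_forall fun n => ?_)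
    have := ENat.toENNReal_mono (hC n)
    simpa using this
  · have hN : ∀ p, dP m lam p ≤ Finset.univ.sup (dP m lam) := fun p =>
      Finset.le_sup (Finset.mem_univ p)
    refine le_trans ?_ (Dynamics.coverEntropyEntourage_le_coverEntropy _ _
      (UN_mem m (Finset.univ.sup (dP m lam))))
    rw [← ExpGrowth.expGrowthSup_pow]
    refine ExpGrowth.expGrowthSup_monotone fun n => ?_
    have := ENat.toENNReal_mono (lower_bound m hm lam _ hN n)
    simpa using this

theorem stmt17 (m : ℕ) (hm : 1 ≤ m) (lam : ℤ →₀ ZMod m) :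
    letI : UniformSpace (ZMod m) := ⊥
    Dynamics.coverEntropy (TCA m lam) Set.univ
      = (((∑ p ∈ m.primeFactors.attach,
            (degP m p.1 (Nat.dvd_of_mem_primeFactors p.2) lam : ℝ)
              * ((m.factorization p.1 : ℝ) * Real.log p.1)) : ℝ) : EReal) := by
  letI : UniformSpace (ZMod m) := ⊥
  show Dynamics.coverEntropy (TCA m lam) Set.univ = _
  rw [entropy_eq m hm lam, ← ENNReal.ofReal_natCast,
    ENNReal.log_ofReal_of_pos (by exact_mod_cast bP_pos m lam)]
  congr 1
  rw [bP, Nat.cast_prod, Real.log_prod, Finset.univ_eq_attach]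
  · refine Finset.sum_congr rfl fun p _ => ?_
    rw [degP_eq m hm lam p]
    push_cast
    rw [Real.log_pow, Real.log_pow]
  · intro p _
    have := (Nat.prime_of_mem_primeFactors p.2).ne_zero
    positivity
end
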